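/- The Hook Theorem (Berele–Regev): the F-dimension of the subalgebra of End_F(W^{⊗r}) generated by the signed swap operators P_1, …, P_{r−1} (i.e., the image of the group algebra F[𝔖_r] under the sign permutation representation on W^{⊗r}) equals Σ_{λ ∈ H(m,n;r)} (f^λ)², the sum over partitions λ of r contained in the (m,n)-hook of the squares of the numbers of standard Young tableaux of shape λ. -/

import Mathlib

set_option synthInstance.maxHeartbeats 1000000
set_option maxHeartbeats 1000000

open scoped BigOperators Kronecker

section CommonDefs

variable {R : Type*} [CommRing R]

/-- ℤ₂-degree of the basis vector `v_{k+1}` (0-based index `k`): `0` if `k < m`, else `1`. -/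
def deg (m : ℕ) {N : ℕ} (k : Fin N) : ℕ := if (k : ℕ) < m then 0 else 1

/-- The sign `(−1)^{|v_k||v_l|}`. -/
def sgn (R : Type*) [CommRing R] (m : ℕ) {N : ℕ} (k l : Fin N) : R :=
  (-1 : R) ^ (deg m k * deg m l)

/-- Entries (row = input vector) of the operator `T` on `V ⊗ V`, where `x` plays the
role of `q` and `xinv` that of `q⁻¹`:  `T(v_k ⊗ v_k) = q·v_k ⊗ v_k` if `k ≤ m`,
`T(v_k ⊗ v_k) = −q⁻¹·v_k ⊗ v_k` if `k > m`,
`T(v_k ⊗ v_l) = (−1)^{|v_k||v_l|} v_l ⊗ v_k + (q−q⁻¹) v_k ⊗ v_l` if `k < l`, and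
`T(v_k ⊗ v_l) = (−1)^{|v_k||v_l|} v_l ⊗ v_k` if `k > l`. -/
def Tent (x xinv : R) (m : ℕ) {N : ℕ} (p p' : Fin N × Fin N) : R :=
  if p.1 = p.2 then (if (p.1 : ℕ) < m then x else -xinv) * (if p' = p then 1 else 0)
  else if (p.1 : ℕ) < (p.2 : ℕ) then
    sgn R m p.1 p.2 * (if p' = (p.2, p.1) then 1 else 0)
      + (x - xinv) * (if p' = p then 1 else 0)
  else sgn R m p.1 p.2 * (if p' = (p.2, p.1) then 1 else 0)

/-- Entries of the signed swap `P(v_k ⊗ v_l) = (−1)^{|v_k||v_l|} v_l ⊗ v_k`. -/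
def Pent (R : Type*) [CommRing R] (m : ℕ) {N : ℕ} (p p' : Fin N × Fin N) : R :=
  sgn R m p.1 p.2 * (if p' = (p.2, p.1) then 1 else 0)

/-- The operator `Id^{⊗ i} ⊗ E ⊗ Id^{⊗ (r−i−2)}` on `V^{⊗ r}` obtained from a two-site
operator `E` acting on the (0-based) tensor positions `i` and `i+1`. -/
def twoSiteOp {N : ℕ} (E : Fin N × Fin N → Fin N × Fin N → R) (r i : ℕ) (h : i + 1 < r) :
    Matrix (Fin r → Fin N) (Fin r → Fin N) R := fun a b =>
  E (a ⟨i, Nat.lt_of_succ_lt h⟩, a ⟨i + 1, h⟩) (b ⟨i, Nat.lt_of_succ_lt h⟩, b ⟨i + 1, h⟩) *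
    ∏ j ∈ Finset.univ \ ({⟨i, Nat.lt_of_succ_lt h⟩, ⟨i + 1, h⟩} : Finset (Fin r)),
      (if a j = b j then (1 : R) else 0)

/-- The Hecke operator `T_{i+1} = Id^{⊗ i} ⊗ T ⊗ Id^{⊗ (r−i−2)}` on `V^{⊗ r}`
(here `i` is the 0-based position of the first tensor factor it acts on). -/
def heckeOp (x xinv : R) (m : ℕ) {N : ℕ} (r i : ℕ) (h : i + 1 < r) :
    Matrix (Fin r → Fin N) (Fin r → Fin N) R :=
  twoSiteOp (Tent x xinv m) r i h

/-- The signed swap operator `P_{i+1} = Id^{⊗ i} ⊗ P ⊗ Id^{⊗ (r−i−2)}` on `V^{⊗ r}`. -/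
def swapOp (R : Type*) [CommRing R] (m : ℕ) {N : ℕ} (r i : ℕ) (h : i + 1 < r) :
    Matrix (Fin r → Fin N) (Fin r → Fin N) R :=
  twoSiteOp (Pent R m) r i h

/-- The parity operator `S v_j = (−1)^{|v_j|} v_j`. -/
def Smat (R : Type*) [CommRing R] (m : ℕ) {N : ℕ} : Matrix (Fin N) (Fin N) R :=
  fun a b => if a = b then (-1 : R) ^ deg m a else 0

/-- The diagonal operator `Q_b v_j = q^{δ_{bj}} v_j` (`x` playing the role of `q`, or of
`q⁻¹` for the inverse operator). -/
def Qmat (x : R) {N : ℕ} (b0 : Fin N) : Matrix (Fin N) (Fin N) R :=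
  fun a b => if a = b then (if a = b0 then x else 1) else 0

/-- `E_k v_{k+1} = v_k`, `E_k v_j = 0` otherwise (0-based `k`; row = input). -/
def Emat (R : Type*) [CommRing R] {N : ℕ} (k : ℕ) : Matrix (Fin N) (Fin N) R :=
  fun a b => if (a : ℕ) = k + 1 ∧ (b : ℕ) = k then 1 else 0

/-- `F_k v_k = v_{k+1}`, `F_k v_j = 0` otherwise (0-based `k`; row = input). -/
def Fmat (R : Type*) [CommRing R] {N : ℕ} (k : ℕ) : Matrix (Fin N) (Fin N) R :=
  fun a b => if (a : ℕ) = k ∧ (b : ℕ) = k + 1 then 1 else 0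

/-- The diagonal operator `D_k v_j = q^{s(k)δ_{kj} − s(k+1)δ_{k+1,j}} v_j`
(0-based `k`, so `s(k) = 1` iff `k < m`, and `s(k) = −1` otherwise). -/
def Dmat (x xinv : R) (m : ℕ) {N : ℕ} (k : ℕ) : Matrix (Fin N) (Fin N) R :=
  fun a b => if a = b then
    (if (a : ℕ) = k then (if k < m then x else xinv)
     else if (a : ℕ) = k + 1 then (if k + 1 < m then xinv else x) else 1)
  else 0

/-- The inverse `D_k⁻¹` of `Dmat` (obtained by exchanging `q` and `q⁻¹`). -/
def Dinvmat (x xinv : R) (m : ℕ) {N : ℕ} (k : ℕ) : Matrix (Fin N) (Fin N) R :=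
  Dmat xinv x m k

/-- `S^{p(k)}`, where `p(k) = 1` if the 0-based `k` satisfies `k + 1 = m` (the odd simple
root) and `p(k) = 0` otherwise. -/
def SPmat (R : Type*) [CommRing R] (m : ℕ) {N : ℕ} (k : ℕ) : Matrix (Fin N) (Fin N) R :=
  if k + 1 = m then Smat R m else 1

/-- Kronecker (tensor) product of `r` one-site operators, as a matrix on `V^{⊗ r}`. -/
def kron {N r : ℕ} (M : Fin r → Matrix (Fin N) (Fin N) R) :
    Matrix (Fin r → Fin N) (Fin r → Fin N) R :=
  fun a b => ∏ j, M j (a j) (b j)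

/-- `ρ_r(σ) = S^{⊗ r}`. -/
def rhoSigma (R : Type*) [CommRing R] (m : ℕ) {N : ℕ} (r : ℕ) :
    Matrix (Fin r → Fin N) (Fin r → Fin N) R :=
  kron fun _ => Smat R m

/-- `ρ_r(q^{δ_b}) = Q_b^{⊗ r}` (and its inverse, substituting `q⁻¹` for `x`). -/
def rhoQ (x : R) {N : ℕ} (r : ℕ) (b0 : Fin N) :
    Matrix (Fin r → Fin N) (Fin r → Fin N) R :=
  kron fun _ => Qmat x b0

/-- `ρ_r(e_k) = Σ_{j=1}^{r} (S^{p(k)})^{⊗(j−1)} ⊗ E_k ⊗ (D_k^{−1})^{⊗(r−j)}`. -/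
def rhoE (x xinv : R) (m : ℕ) {N : ℕ} (r : ℕ) (k : ℕ) :
    Matrix (Fin r → Fin N) (Fin r → Fin N) R :=
  ∑ p : Fin r, kron fun j =>
    if j < p then SPmat R m k else if j = p then Emat R k else Dinvmat x xinv m k

/-- `ρ_r(f_k) = Σ_{j=1}^{r} (S^{p(k)}D_k)^{⊗(j−1)} ⊗ F_k ⊗ Id^{⊗(r−j)}`. -/
def rhoF (x xinv : R) (m : ℕ) {N : ℕ} (r : ℕ) (k : ℕ) :
    Matrix (Fin r → Fin N) (Fin r → Fin N) R :=
  ∑ p : Fin r, kron fun j =>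
    if j < p then SPmat R m k * Dmat x xinv m k else if j = p then Fmat R k else 1

/-- The generators `T_1, …, T_{r−1}` of the image of the sign `q`-permutation
representation of the Iwahori–Hecke algebra on `V^{⊗ r}`. -/
def heckeGens (x xinv : R) (m : ℕ) {N : ℕ} (r : ℕ) :
    Set (Matrix (Fin r → Fin N) (Fin r → Fin N) R) :=
  {M | ∃ (i : ℕ) (h : i + 1 < r), M = heckeOp x xinv m r i h}

/-- The signed-swap generators `P_1, …, P_{r−1}` (the `q → 1` specialization). -/
def swapGens (R : Type*) [CommRing R] (m : ℕ) {N : ℕ} (r : ℕ) :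
    Set (Matrix (Fin r → Fin N) (Fin r → Fin N) R) :=
  {M | ∃ (i : ℕ) (h : i + 1 < r), M = swapOp R m r i h}

/-- The generators `ρ_r(σ)`, `ρ_r(q^{± δ_b})` (`1 ≤ b ≤ N`), `ρ_r(e_k)`, `ρ_r(f_k)`
(`1 ≤ k ≤ N−1`) of the image of the vector representation of `U_q^σ(gl(m,n))`. -/
def quantumGens (x xinv : R) (m : ℕ) {N : ℕ} (r : ℕ) :
    Set (Matrix (Fin r → Fin N) (Fin r → Fin N) R) :=
  {rhoSigma R m r} ∪ (Set.range fun b : Fin N => rhoQ x r b)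
    ∪ (Set.range fun b : Fin N => rhoQ xinv r b)
    ∪ (Set.range fun k : Fin (N - 1) => rhoE x xinv m r (k : ℕ))
    ∪ (Set.range fun k : Fin (N - 1) => rhoF x xinv m r (k : ℕ))

end CommonDefs

/-- Cell membership in the Young diagram of a partition `lam` of `r`: the (0-based) cell
`(i, j)` lies in the diagram iff more than `i` parts of `lam` exceed `j`
(equivalently, `j < λ_{i+1}`). -/
def cellIn {r : ℕ} (lam : Nat.Partition r) (c : ℕ × ℕ) : Prop :=
  c.1 < (lam.parts.filter fun p => c.2 < p).card

/-- `f^λ`: the number of standard Young tableaux of shape `lam`, i.e. bijective fillings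
of the cells of the Young diagram of `lam` by `1, …, r` that strictly increase along
each row and down each column. -/
noncomputable def fSYT {r : ℕ} (lam : Nat.Partition r) : ℕ :=
  Nat.card {f : {c : ℕ × ℕ // cellIn lam c} → Fin r //
    Function.Bijective f ∧
      (∀ c d : {c : ℕ × ℕ // cellIn lam c}, c.1.1 = d.1.1 → c.1.2 < d.1.2 → f c < f d) ∧
      (∀ c d : {c : ℕ × ℕ // cellIn lam c}, c.1.2 = d.1.2 → c.1.1 < d.1.1 → f c < f d)}

/-- The `(m,n)`-hook `H(m,n;r)`: partitions `λ = (λ_1 ≥ λ_2 ≥ …)` of `r` with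
`λ_j ≤ n` for all `j > m`, i.e. at most `m` parts exceed `n`. -/
def hookFinset (m n r : ℕ) : Finset (Nat.Partition r) :=
  Finset.univ.filter fun lam => (lam.parts.filter fun p => n < p).card ≤ m

section CoxeterPresentation

open Equiv

variable {M : Type*} [Monoid M]

/-- The product `g (k-1) * g (k-2) * ⋯` of `d` factors with descending indices. -/
def descProd (g : ℕ → M) : ℕ → ℕ → M
  | _, 0 => 1
  | 0, _ + 1 => 1
  | k + 1, d + 1 => g k * descProd g k d

/-- The submonoid generated by the first `k` terms of a sequence. -/
def firstClosure (g : ℕ → M) (k : ℕ) : Submonoid M :=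
  Submonoid.closure (g '' Set.Iio k)

/-- The braid relations (with quadratic relation `x² = 1`) for the first `N` terms of `g`. -/
structure IsCoxeterA (g : ℕ → M) (N : ℕ) : Prop where
  mul_self : ∀ i < N, g i * g i = 1
  braid : ∀ i, i + 1 < N → g i * g (i + 1) * g i = g (i + 1) * g i * g (i + 1)
  comm : ∀ i j, i + 1 < j → j < N → g i * g j = g j * g i

lemma mem_firstClosure (g : ℕ → M) {i k : ℕ} (h : i < k) : g i ∈ firstClosure g k :=
  Submonoid.subset_closure ⟨i, h, rfl⟩

lemma firstClosure_mono (g : ℕ → M) {k l : ℕ} (h : k ≤ l) :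
    firstClosure g k ≤ firstClosure g l :=
  Submonoid.closure_mono (Set.image_mono (Set.Iio_subset_Iio h))

lemma descProd_mem (g : ℕ → M) (k d : ℕ) : descProd g k d ∈ firstClosure g k := by
  induction k generalizing d with
  | zero => cases d <;> exact one_mem _
  | succ k ih =>
    cases d with
    | zero => exact one_mem _
    | succ d =>
      exact mul_mem (mem_firstClosure g k.lt_succ_self) (firstClosure_mono g k.le_succ (ih d))

lemma IsCoxeterA.commute_of_mem {g : ℕ → M} {N : ℕ} (hg : IsCoxeterA g N) {k : ℕ} (hk : k < N)
    {x : M} (hx : x ∈ firstClosure g (k - 1)) : g k * x = x * g k := by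
  induction hx using Submonoid.closure_induction with
  | mem x hx =>
    obtain ⟨i, hi, rfl⟩ := hx
    simp only [Set.mem_Iio] at hi
    exact (hg.comm i k (by omega) hk).symm
  | one => simp
  | mul x y _ _ hx hy => rw [← mul_assoc, hx, mul_assoc, hy, mul_assoc]

lemma IsCoxeterA.descProd_mul {g : ℕ → M} {N : ℕ} (hg : IsCoxeterA g N) {k : ℕ} (hk : k ≤ N)
    {d i : ℕ} (hd : d ≤ k) (hi : i < k) :
    ∃ h ∈ firstClosure g (k - 1), ∃ d' ≤ k, descProd g k d * g i = h * descProd g k d' := by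
  induction k generalizing d i with
  | zero => omega
  | succ k ih =>
    rw [Nat.add_sub_cancel]
    rcases d with _ | d
    · rcases (Nat.lt_succ_iff_lt_or_eq.mp hi) with hik | rfl
      · exact ⟨g i, mem_firstClosure g hik, 0, by omega, by simp [descProd]⟩
      · exact ⟨1, one_mem _, 1, by omega, by simp [descProd]⟩
    · rcases (Nat.lt_succ_iff_lt_or_eq.mp hi) with hik | rfl
      · obtain ⟨h, hh, d', hd', e⟩ := ih (by omega) (d := d) (by omega) hik
        refine ⟨h, firstClosure_mono g (by omega) hh, d' + 1, by omega, ?_⟩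
        simp only [descProd]
        rw [mul_assoc, e, ← mul_assoc, hg.commute_of_mem (by omega) hh, mul_assoc]
      · rcases d with _ | e
        · exact ⟨1, one_mem _, 0, by omega, by simp [descProd, hg.mul_self i (by omega)]⟩
        · obtain ⟨k, rfl⟩ : ∃ k, i = k + 1 := ⟨i - 1, by omega⟩
          refine ⟨g k, mem_firstClosure g k.lt_succ_self, e + 2, by omega, ?_⟩
          have hc := hg.commute_of_mem (k := k + 1) (by omega) (descProd_mem g k e)
          simp only [descProd]
          rw [mul_assoc, mul_assoc, ← hc, ← mul_assoc, ← mul_assoc, ← mul_assoc, ← mul_assoc,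
            hg.braid k (by omega)]

lemma IsCoxeterA.firstClosure_subset {g : ℕ → M} {N : ℕ} (hg : IsCoxeterA g N) {k : ℕ}
    (hk : k < N) :
    (firstClosure g (k + 1) : Set M) ⊆
      Set.image2 (fun h d => h * descProd g (k + 1) d) (firstClosure g k) (Set.Iio (k + 2)) := by
  intro x hx
  induction hx using Submonoid.closure_induction_right with
  | one => exact ⟨1, one_mem _, 0, by simp, by simp [descProd]⟩
  | mul_right x _ y hy ih =>
    obtain ⟨i, hi, rfl⟩ := hy
    obtain ⟨h, hh, d, hd, rfl⟩ := ih
    simp only [Set.mem_Iio] at hi hd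
    obtain ⟨h', hh', d', hd', e⟩ := hg.descProd_mul (k := k + 1) (by omega) (d := d) (by omega) hi
    refine ⟨h * h', mul_mem hh hh', d', by simp only [Set.mem_Iio]; omega, ?_⟩
    simp only [mul_assoc, e]

lemma IsCoxeterA.encard_firstClosure_le {g : ℕ → M} {N : ℕ} (hg : IsCoxeterA g N) {k : ℕ}
    (hk : k ≤ N) : (firstClosure g k : Set M).encard ≤ ((k + 1).factorial : ℕ) := by
  induction k with
  | zero => simp [firstClosure]
  | succ k ih =>
    refine (Set.encard_le_encard (hg.firstClosure_subset hk)).trans ?_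
    rw [← Set.image_prod]
    refine (Set.encard_image_le _ _).trans ?_
    rw [Set.encard_prod, Nat.factorial_succ (k + 1), mul_comm]
    push_cast
    refine mul_le_mul' ?_ (ih (by omega))
    rw [← Finset.coe_range, Set.encard_coe_eq_coe_finsetCard, Finset.card_range]
    norm_cast

/-- The adjacent transposition exchanging `i` and `i + 1`. -/
abbrev adjSwap {N : ℕ} (i : Fin N) : Perm (Fin (N + 1)) := swap i.castSucc i.succ

lemma adjSwap_mul_self {N : ℕ} (i : Fin N) : adjSwap i * adjSwap i = 1 := swap_mul_self _ _

lemma adjSwap_braid {N : ℕ} (i j : Fin N) (h : (i : ℕ) + 1 = j) :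
    adjSwap i * adjSwap j * adjSwap i = adjSwap j * adjSwap i * adjSwap j := by
  have hij : i.succ = j.castSucc := by ext; simpa using h
  have h1 : i.castSucc ≠ j.castSucc := by rw [Ne, Fin.ext_iff]; simp; omega
  have h2 : i.castSucc ≠ j.succ := by rw [Ne, Fin.ext_iff]; simp; omega
  have h3 : j.castSucc ≠ j.succ := by rw [Ne, Fin.ext_iff]; simp
  unfold adjSwap
  have e1 := swap_mul_swap_mul_swap h3.symm h2.symm
  have e2 := swap_mul_swap_mul_swap h1 h2
  rw [hij]
  rw [swap_comm j.succ, swap_comm j.castSucc i.castSucc] at e1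
  rw [e1, e2, swap_comm]

lemma adjSwap_comm {N : ℕ} (i j : Fin N) (h : (i : ℕ) + 1 < j) :
    adjSwap i * adjSwap j = adjSwap j * adjSwap i := by
  apply Perm.Disjoint.commute
  apply Perm.disjoint_swap_swap
  simp [Fin.ext_iff]
  omega

/-- The Coxeter presentation of the symmetric group: elements of a monoid satisfying the braid
relations are the images of the adjacent transpositions under a homomorphism. -/
theorem exists_perm_hom {N : ℕ} (g : Fin N → M) (h1 : ∀ i, g i * g i = 1)
    (h2 : ∀ i j : Fin N, (i : ℕ) + 1 = j → g i * g j * g i = g j * g i * g j)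
    (h3 : ∀ i j : Fin N, (i : ℕ) + 1 < j → g i * g j = g j * g i) :
    ∃ φ : Perm (Fin (N + 1)) →* M, ∀ i, φ (adjSwap i) = g i := by
  let γ : ℕ → Perm (Fin (N + 1)) × M := fun i =>
    if h : i < N then (adjSwap ⟨i, h⟩, g ⟨i, h⟩) else 1
  have hγ : ∀ i : Fin N, γ i = (adjSwap i, g i) := fun i => by simp [γ]
  have hcox : IsCoxeterA γ N := by
    refine ⟨fun i hi => ?_, fun i hi => ?_, fun i j hij hj => ?_⟩
    · have := hγ ⟨i, hi⟩
      simp only at this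
      rw [this, Prod.mk_mul_mk, adjSwap_mul_self, h1, Prod.mk_one_one]
    · have e1 := hγ ⟨i, by omega⟩
      have e2 := hγ ⟨i + 1, hi⟩
      simp only at e1 e2
      rw [e1, e2]
      simp only [Prod.mk_mul_mk]
      rw [adjSwap_braid _ _ rfl, h2 _ _ rfl]
    · have e1 := hγ ⟨i, by omega⟩
      have e2 := hγ ⟨j, hj⟩
      simp only at e1 e2
      rw [e1, e2]
      simp only [Prod.mk_mul_mk]
      rw [adjSwap_comm _ _ hij, h3 _ _ hij]
  let H := firstClosure γ N
  let p : H →* Perm (Fin (N + 1)) := (MonoidHom.fst _ _).comp H.subtype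
  have hcard := hcox.encard_firstClosure_le le_rfl
  have hfin : (H : Set (Perm (Fin (N + 1)) × M)).Finite :=
    Set.finite_of_encard_le_coe hcard
  have : Finite H := hfin
  have hsurj : Function.Surjective p := by
    rw [← MonoidHom.mrange_eq_top, eq_top_iff, ← Perm.mclosure_swap_castSucc_succ,
      Submonoid.closure_le]
    rintro _ ⟨i, rfl⟩
    exact ⟨⟨γ i, mem_firstClosure γ i.2⟩, by simp [p, hγ, adjSwap]⟩
  have hle : Nat.card H ≤ Nat.card (Perm (Fin (N + 1))) := by
    rw [Nat.card_perm, Nat.card_fin]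
    have := hfin.cast_ncard_eq
    rw [← this] at hcard
    exact_mod_cast hcard
  have hbij : Function.Bijective p := by
    exact hsurj.bijective_of_nat_card_le hle
  let e := MulEquiv.ofBijective p hbij
  refine ⟨((MonoidHom.snd _ _).comp H.subtype).comp e.symm.toMonoidHom, fun i => ?_⟩
  have he : e.symm (adjSwap i) = ⟨γ i, mem_firstClosure γ i.2⟩ := by
    rw [MulEquiv.symm_apply_eq]
    simp [e, p, hγ]
  simp [he, hγ]

end CoxeterPresentation

section Tableaux

open Equiv

/-- A standard tableau with `r` cells, recorded by the positions `t k` of its entries `k`: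
the cells below or equal to `t k` carry entries at most `k`. -/
def IsStd {r : ℕ} (t : Fin r → ℕ × ℕ) : Prop :=
  Function.Injective t ∧ ∀ k c, c ≤ t k → ∃ j ≤ k, t j = c

/-- The type of standard tableaux with `r` cells. -/
abbrev StdTab (r : ℕ) : Type := {t : Fin r → ℕ × ℕ // IsStd t}

lemma IsStd.le_of_le {r : ℕ} {t : Fin r → ℕ × ℕ} (ht : IsStd t) {i j : Fin r}
    (h : t i ≤ t j) : i ≤ j := by
  obtain ⟨k, hk, e⟩ := ht.2 j _ h
  rwa [← ht.1 e]

lemma IsStd.bounds {r : ℕ} {t : Fin r → ℕ × ℕ} (ht : IsStd t) (k : Fin r) :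
    (t k).1 ≤ k ∧ (t k).2 ≤ k := by
  obtain ⟨k, hk⟩ := k
  induction k using Nat.strong_induction_on with
  | _ k ih =>
    constructor
    · by_contra! hlt
      obtain ⟨j, hj, e⟩ := ht.2 ⟨k, hk⟩ ((t ⟨k, hk⟩).1 - 1, (t ⟨k, hk⟩).2) ⟨by simp, le_rfl⟩
      have hne : j ≠ ⟨k, hk⟩ := by
        rintro rfl
        have := congrArg Prod.fst e
        simp only at this hlt
        omega
      have hjk : (j : ℕ) < k := lt_of_le_of_ne hj (fun e => hne (Fin.ext e))
      have := (ih j hjk j.2).1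
      rw [Fin.eta, e] at this
      simp only at this hlt
      omega
    · by_contra! hlt
      obtain ⟨j, hj, e⟩ := ht.2 ⟨k, hk⟩ ((t ⟨k, hk⟩).1, (t ⟨k, hk⟩).2 - 1) ⟨le_rfl, by simp⟩
      have hne : j ≠ ⟨k, hk⟩ := by
        rintro rfl
        have := congrArg Prod.snd e
        simp only at this hlt
        omega
      have hjk : (j : ℕ) < k := lt_of_le_of_ne hj (fun e => hne (Fin.ext e))
      have := (ih j hjk j.2).2
      rw [Fin.eta, e] at this
      simp only at this hlt
      omega

instance StdTab.finite (r : ℕ) : Finite (StdTab r) := by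
  let f : StdTab r → (Fin r → Fin r × Fin r) := fun t k =>
    (⟨(t.1 k).1, (t.2.bounds k).1.trans_lt k.2⟩, ⟨(t.1 k).2, (t.2.bounds k).2.trans_lt k.2⟩)
  refine Finite.of_injective f fun s t h => ?_
  ext k : 2
  have := congrFun h k
  simp only [f, Prod.mk.injEq, Fin.mk.injEq] at this
  exact Prod.ext this.1 this.2

noncomputable instance StdTab.fintype (r : ℕ) : Fintype (StdTab r) := Fintype.ofFinite _

/-- The content (column minus row) of a cell. -/
def content (c : ℕ × ℕ) : ℤ := c.2 - c.1

lemma IsStd.le_of_content_eq {r : ℕ} {t : Fin r → ℕ × ℕ} (ht : IsStd t) {i j : Fin r}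
    (hij : i < j) (hc : content (t i) = content (t j)) : (i : ℕ) + 3 ≤ j := by
  have hnle : ¬ t j ≤ t i := fun h => (ht.le_of_le h).not_gt hij
  have hne : t i ≠ t j := fun h => hij.ne (ht.1 h)
  unfold content at hc
  rw [Prod.le_def] at hnle
  rw [Ne, Prod.ext_iff] at hne
  obtain ⟨k, hk, ek⟩ := ht.2 j ((t i).1 + 1, (t i).2) ⟨by simp only; omega, by simp only; omega⟩
  obtain ⟨l, hl, el⟩ := ht.2 j ((t i).1, (t i).2 + 1) ⟨by simp only; omega, by simp only; omega⟩
  have hik : i ≤ k := ht.le_of_le (by rw [ek]; exact ⟨by simp, le_rfl⟩)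
  have hil : i ≤ l := ht.le_of_le (by rw [el]; exact ⟨le_rfl, by simp⟩)
  have h1 : i ≠ k := by rintro rfl; have := congrArg Prod.fst ek; simp at this
  have h2 : i ≠ l := by rintro rfl; have := congrArg Prod.snd el; simp at this
  have h3 : k ≠ l := by
    rintro rfl; have := congrArg Prod.fst ek; have := congrArg Prod.fst el; simp_all
  have h4 : k ≠ j := by
    rintro rfl
    have := congrArg Prod.fst ek; have := congrArg Prod.snd ek; simp only at *; omega
  have h5 : l ≠ j := by
    rintro rfl
    have := congrArg Prod.fst el; have := congrArg Prod.snd el; simp only at *; omega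
  rw [Ne, Fin.ext_iff] at h1 h2 h3 h4 h5
  rw [Fin.le_def] at *
  omega

/-- Standard tableaux are determined by the contents of their entries. -/
lemma IsStd.eq_of_content_eq {r : ℕ} {s t : Fin r → ℕ × ℕ} (hs : IsStd s) (ht : IsStd t)
    (h : ∀ k, content (s k) = content (t k)) : s = t := by
  have key : ∀ {s t : Fin r → ℕ × ℕ}, IsStd s → IsStd t → ∀ k, (∀ j < k, s j = t j) →
      s k ≤ t k → s k = t k := by
    intro s t hs ht k hlt hle
    obtain ⟨j, hj, e⟩ := ht.2 k _ hle
    rcases hj.lt_or_eq with hj | rfl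
    · rw [← hlt j hj] at e
      exact absurd (hs.1 e) hj.ne
    · exact e.symm
  funext k
  induction k using WellFoundedLT.induction with
  | _ k ih =>
    have hk := h k
    unfold content at hk
    rcases le_total (s k).1 (t k).1 with hle | hle
    · exact key hs ht k ih ⟨hle, by omega⟩
    · exact (key ht hs k (fun j hj => (ih j hj).symm) ⟨hle, by omega⟩).symm

/-- The difference of the contents of the entries `i + 1` and `i`. -/
def axialDist {N : ℕ} (t : Fin (N + 1) → ℕ × ℕ) (i : Fin N) : ℤ :=
  content (t i.succ) - content (t i.castSucc)

lemma IsStd.axialDist_ne_zero {N : ℕ} {t : Fin (N + 1) → ℕ × ℕ} (ht : IsStd t) (i : Fin N) :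
    axialDist t i ≠ 0 := by
  intro h
  have := ht.le_of_content_eq (Fin.castSucc_lt_succ (i := i)) (by unfold axialDist at h; omega)
  simp at this

lemma IsStd.adjacent {N : ℕ} {t : Fin (N + 1) → ℕ × ℕ} (ht : IsStd t) (i : Fin N)
    (h : t i.castSucc ≤ t i.succ) :
    t i.succ = ((t i.castSucc).1, (t i.castSucc).2 + 1) ∨
      t i.succ = ((t i.castSucc).1 + 1, (t i.castSucc).2) := by
  have hne : t i.castSucc ≠ t i.succ := fun e => (Fin.castSucc_lt_succ (i := i)).ne (ht.1 e)
  have key : ∀ c, t i.castSucc ≤ c → c ≤ t i.succ → c ≠ t i.succ → c = t i.castSucc := by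
    intro c h1 h2 h3
    obtain ⟨j, hj, rfl⟩ := ht.2 _ c h2
    have hij := ht.le_of_le h1
    have : j ≠ i.succ := fun e => h3 (by rw [e])
    congr 1
    rw [Fin.ext_iff]
    rw [Ne, Fin.ext_iff] at this
    rw [Fin.le_def] at hj hij
    simp only [Fin.val_castSucc, Fin.val_succ] at *
    omega
  rw [Ne, Prod.ext_iff] at hne
  obtain ⟨h1, h2⟩ := Prod.le_def.mp h
  rcases h1.lt_or_eq with h1 | h1
  · right
    have := key ((t i.succ).1 - 1, (t i.succ).2) ⟨by simp only; omega, h2⟩ ⟨by simp, le_rfl⟩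
      (by rw [Ne, Prod.ext_iff]; simp only; omega)
    rw [Prod.ext_iff] at this ⊢
    simp only at *
    omega
  · left
    have := key ((t i.succ).1, (t i.succ).2 - 1) ⟨by simp only; omega, by simp only; omega⟩
      ⟨le_rfl, by simp⟩ (by rw [Ne, Prod.ext_iff]; simp only; omega)
    rw [Prod.ext_iff] at this ⊢
    simp only at *
    omega

lemma IsStd.of_axialDist_eq_one {N : ℕ} {t : Fin (N + 1) → ℕ × ℕ} (ht : IsStd t) (i : Fin N)
    (h : axialDist t i = 1) : (t i.succ).1 = (t i.castSucc).1 := by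
  have hn : ¬ t i.succ ≤ t i.castSucc := fun e =>
    (ht.le_of_le e).not_gt Fin.castSucc_lt_succ
  rw [Prod.le_def] at hn
  unfold axialDist content at h
  have := ht.adjacent i (Prod.le_def.mpr (by omega))
  simp only [Prod.ext_iff] at this
  omega

lemma IsStd.of_axialDist_eq_neg_one {N : ℕ} {t : Fin (N + 1) → ℕ × ℕ} (ht : IsStd t)
    (i : Fin N) (h : axialDist t i = -1) : (t i.succ).2 = (t i.castSucc).2 := by
  have hn : ¬ t i.succ ≤ t i.castSucc := fun e =>
    (ht.le_of_le e).not_gt Fin.castSucc_lt_succ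
  rw [Prod.le_def] at hn
  unfold axialDist content at h
  have := ht.adjacent i (Prod.le_def.mpr (by omega))
  simp only [Prod.ext_iff] at this
  omega

lemma IsStd.axialDist_of_row {N : ℕ} {t : Fin (N + 1) → ℕ × ℕ} (ht : IsStd t) (i : Fin N)
    (h : (t i.succ).1 = (t i.castSucc).1) : axialDist t i = 1 := by
  have hn : ¬ t i.succ ≤ t i.castSucc := fun e =>
    (ht.le_of_le e).not_gt Fin.castSucc_lt_succ
  rw [Prod.le_def] at hn
  unfold axialDist content
  have := ht.adjacent i (Prod.le_def.mpr (by omega))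
  simp only [Prod.ext_iff] at this
  omega

lemma IsStd.axialDist_of_col {N : ℕ} {t : Fin (N + 1) → ℕ × ℕ} (ht : IsStd t) (i : Fin N)
    (h : (t i.succ).2 = (t i.castSucc).2) : axialDist t i = -1 := by
  have hn : ¬ t i.succ ≤ t i.castSucc := fun e =>
    (ht.le_of_le e).not_gt Fin.castSucc_lt_succ
  rw [Prod.le_def] at hn
  unfold axialDist content
  have := ht.adjacent i (Prod.le_def.mpr (by omega))
  simp only [Prod.ext_iff] at this
  omega

lemma IsStd.comp_adjSwap {N : ℕ} {t : Fin (N + 1) → ℕ × ℕ} (ht : IsStd t) (i : Fin N)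
    (h1 : axialDist t i ≠ 1) (h2 : axialDist t i ≠ -1) : IsStd (t ∘ adjSwap i) := by
  have hn : ¬ t i.castSucc ≤ t i.succ := by
    intro h
    unfold axialDist content at h1 h2
    have := ht.adjacent i h
    simp only [Prod.ext_iff] at this
    omega
  refine ⟨ht.1.comp (adjSwap i).injective, fun k c hc => ?_⟩
  obtain ⟨j, hj, rfl⟩ := ht.2 _ c hc
  refine ⟨adjSwap i j, ?_, by simp [adjSwap]⟩
  by_contra! hlt
  have hj' : j ≠ i.castSucc ∨ adjSwap i k ≠ i.succ := by
    by_contra! e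
    simp only [Function.comp_apply] at hc
    rw [e.2, e.1] at hc
    exact hn hc
  rw [Fin.le_def] at hj
  rw [Fin.lt_def] at hlt
  simp only [adjSwap, swap_apply_def] at *
  split_ifs at * <;> simp_all [Fin.ext_iff] <;> omega

/-- The cells of a standard tableau. -/
def tabShape {r : ℕ} (t : Fin r → ℕ × ℕ) : Finset (ℕ × ℕ) := Finset.univ.image t

lemma mem_tabShape {r : ℕ} {t : Fin r → ℕ × ℕ} {c : ℕ × ℕ} :
    c ∈ tabShape t ↔ ∃ k, t k = c := by simp [tabShape]

lemma tabShape_comp_perm {r : ℕ} (t : Fin r → ℕ × ℕ) (g : Perm (Fin r)) :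
    tabShape (t ∘ g) = tabShape t := by
  ext c
  simp only [mem_tabShape, Function.comp_apply]
  exact (g.surjective.exists (p := fun k => t k = c)).symm

lemma IsStd.isLowerSet_tabShape {r : ℕ} {t : Fin r → ℕ × ℕ} (ht : IsStd t) :
    IsLowerSet (tabShape t : Set (ℕ × ℕ)) := by
  intro a b hba ha
  obtain ⟨k, rfl⟩ := mem_tabShape.mp ha
  obtain ⟨j, -, rfl⟩ := ht.2 k b hba
  exact mem_tabShape.mpr ⟨j, rfl⟩

lemma IsStd.card_tabShape {r : ℕ} {t : Fin r → ℕ × ℕ} (ht : IsStd t) :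
    (tabShape t).card = r := by
  rw [tabShape, Finset.card_image_of_injective _ ht.1, Finset.card_univ, Fintype.card_fin]

/-- Exchanging two neighbouring values in descending order increases `∑ k * f k`. -/
lemma sum_mul_comp_adjSwap {N : ℕ} (f : Fin (N + 1) → ℕ) (i : Fin N)
    (h : f i.succ < f i.castSucc) :
    ∑ k : Fin (N + 1), (k : ℕ) * f k < ∑ k : Fin (N + 1), (k : ℕ) * (f ∘ adjSwap i) k := by
  have e : ∀ k : Fin (N + 1), k ≠ i.castSucc → k ≠ i.succ →
      (k : ℕ) * (f ∘ adjSwap i) k = (k : ℕ) * f k := by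
    intro k h1 h2
    simp [adjSwap, swap_apply_of_ne_of_ne h1 h2]
  have hne : i.succ ≠ i.castSucc := (Fin.castSucc_lt_succ (i := i)).ne'
  rw [← Finset.add_sum_erase _ _ (Finset.mem_univ i.castSucc),
    ← Finset.add_sum_erase _ _ (Finset.mem_univ i.castSucc),
    ← Finset.add_sum_erase _ _ (Finset.mem_erase.mpr ⟨hne, Finset.mem_univ i.succ⟩),
    ← Finset.add_sum_erase _ _ (Finset.mem_erase.mpr ⟨hne, Finset.mem_univ i.succ⟩)]
  rw [← add_assoc, ← add_assoc]
  refine add_lt_add_of_lt_of_le ?_ (Finset.sum_le_sum fun k hk => ?_)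
  · simp only [adjSwap, Function.comp_apply, swap_apply_left, swap_apply_right, Fin.val_castSucc,
      Fin.val_succ]
    nlinarith
  · simp only [Finset.mem_erase] at hk
    rw [e k hk.2.1 hk.1]

/-- Same-shape standard tableaux are connected by admissible transpositions. -/
lemma StdTab.rel_of_shape_eq {N : ℕ} (R : StdTab (N + 1) → StdTab (N + 1) → Prop)
    (hrefl : ∀ s, R s s) (hsymm : ∀ s t, R s t → R t s)
    (htrans : ∀ s t u, R s t → R t u → R s u)
    (hswap : ∀ (s t : StdTab (N + 1)) (i : Fin N), axialDist s.1 i ≠ 1 → axialDist s.1 i ≠ -1 →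
      t.1 = s.1 ∘ adjSwap i → R s t)
    {s t : StdTab (N + 1)} (h : tabShape s.1 = tabShape t.1) : R s t := by
  have key : ∀ s : StdTab (N + 1), ∃ u : StdTab (N + 1), R s u ∧ tabShape u.1 = tabShape s.1 ∧
      StrictMono fun k => toLex (u.1 k).swap := by
    intro s
    obtain ⟨u, hu, hmax⟩ := Set.exists_max_image
      {u : StdTab (N + 1) | R s u ∧ tabShape u.1 = tabShape s.1}
      (fun u => ∑ k : Fin (N + 1), (k : ℕ) * (u.1 k).2) (Set.toFinite _) ⟨s, hrefl s, rfl⟩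
    refine ⟨u, hu.1, hu.2, Fin.strictMono_iff_lt_succ.mpr fun i => ?_⟩
    have hcol : (u.1 i.castSucc).2 ≤ (u.1 i.succ).2 := by
      by_contra! hlt
      have h1 : axialDist u.1 i ≠ 1 := by
        intro h
        have h' := u.2.of_axialDist_eq_one i h
        unfold axialDist content at h
        omega
      have h2 : axialDist u.1 i ≠ -1 := by
        intro h
        have h' := u.2.of_axialDist_eq_neg_one i h
        omega
      let v : StdTab (N + 1) := ⟨u.1 ∘ adjSwap i, u.2.comp_adjSwap i h1 h2⟩
      have hv := hmax v ⟨htrans _ _ _ hu.1 (hswap u v i h1 h2 rfl),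
        (tabShape_comp_perm _ _).trans hu.2⟩
      exact hv.not_gt (sum_mul_comp_adjSwap (fun k => (u.1 k).2) i hlt)
    rw [Prod.Lex.toLex_lt_toLex]
    rcases hcol.lt_or_eq with hlt | heq
    · exact Or.inl hlt
    · refine Or.inr ⟨heq, ?_⟩
      have hd := u.2.axialDist_of_col i heq.symm
      unfold axialDist content at hd
      simp only [Prod.snd_swap]
      omega
  obtain ⟨s', hs, hs', hsm⟩ := key s
  obtain ⟨t', ht, ht', htm⟩ := key t
  have : s' = t' := by
    have hr : Set.range (fun k => toLex (s'.1 k).swap) =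
        Set.range (fun k => toLex (t'.1 k).swap) := by
      have : Set.range s'.1 = Set.range t'.1 := by
        ext c
        have := Finset.ext_iff.mp (hs'.trans (h.trans ht'.symm)) c
        simpa only [mem_tabShape, Set.mem_range] using this
      have e : ∀ f : Fin (N + 1) → ℕ × ℕ, Set.range (fun k => toLex (f k).swap) =
          (fun c => toLex (Prod.swap c)) '' Set.range f := fun f => by
        rw [← Set.range_comp]; rfl
      rw [e, e, this]
    have := (StrictMono.range_inj hsm htm).mp hr
    ext k : 2
    have hk := congrFun this k
    exact Prod.swap_injective (toLex.injective hk)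
  subst this
  exact htrans _ _ _ hs (hsymm _ _ ht)

end Tableaux

section Counting

open scoped Classical in
/-- The number of standard tableaux with `r` entries of shape `D`. -/
noncomputable def numStd (r : ℕ) (D : Finset (ℕ × ℕ)) : ℕ :=
  (Finset.univ.filter fun t : StdTab r => tabShape t.1 = D).card

lemma numStd_eq_zero {r : ℕ} {D : Finset (ℕ × ℕ)} (h : ¬ IsLowerSet (D : Set (ℕ × ℕ))) :
    numStd r D = 0 := by
  classical
  rw [numStd, Finset.card_eq_zero, Finset.filter_eq_empty_iff]
  rintro t - rfl
  exact h t.2.isLowerSet_tabShape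

lemma IsStd.init {r : ℕ} {t : Fin (r + 1) → ℕ × ℕ} (ht : IsStd t) :
    IsStd (fun k : Fin r => t k.castSucc) := by
  refine ⟨ht.1.comp (Fin.castSucc_injective r), fun k c hc => ?_⟩
  obtain ⟨j, hj, rfl⟩ := ht.2 _ c hc
  have hlt : (j : ℕ) < r := lt_of_le_of_lt hj k.2
  exact ⟨⟨j, hlt⟩, hj, rfl⟩

lemma IsStd.snoc {r : ℕ} {t : Fin r → ℕ × ℕ} (ht : IsStd t) {d : ℕ × ℕ}
    (hd : d ∉ tabShape t) (hl : ∀ c ≤ d, c ≠ d → c ∈ tabShape t) :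
    IsStd (Fin.snoc (α := fun _ => ℕ × ℕ) t d) := by
  constructor
  · intro i j
    induction i using Fin.lastCases with
    | last =>
      induction j using Fin.lastCases with
      | last => simp
      | cast j =>
        simp only [Fin.snoc_last, Fin.snoc_castSucc]
        exact fun e => absurd (mem_tabShape.mpr ⟨j, e.symm⟩) hd
    | cast i =>
      induction j using Fin.lastCases with
      | last =>
        simp only [Fin.snoc_last, Fin.snoc_castSucc]
        exact fun e => absurd (mem_tabShape.mpr ⟨i, e⟩) hd
      | cast j =>
        simp only [Fin.snoc_castSucc]
        exact fun e => congrArg _ (ht.1 e)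
  · intro k c hc
    induction k using Fin.lastCases with
    | last =>
      rw [Fin.snoc_last] at hc
      by_cases e : c = d
      · exact ⟨Fin.last r, le_rfl, by rw [Fin.snoc_last, e]⟩
      · obtain ⟨j, hj⟩ := mem_tabShape.mp (hl c hc e)
        exact ⟨j.castSucc, Fin.le_last _, by rw [Fin.snoc_castSucc, hj]⟩
    | cast k =>
      rw [Fin.snoc_castSucc] at hc
      obtain ⟨j, hj, rfl⟩ := ht.2 k c hc
      exact ⟨j.castSucc, hj, by rw [Fin.snoc_castSucc]⟩

lemma tabShape_succ {r : ℕ} (t : Fin (r + 1) → ℕ × ℕ) :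
    tabShape t = insert (t (Fin.last r)) (tabShape fun k : Fin r => t k.castSucc) := by
  ext c
  simp only [mem_tabShape, Finset.mem_insert, Fin.exists_fin_succ', eq_comm (a := c)]
  exact or_comm

lemma IsStd.last_notMem {r : ℕ} {t : Fin (r + 1) → ℕ × ℕ} (ht : IsStd t) :
    t (Fin.last r) ∉ tabShape fun k : Fin r => t k.castSucc := by
  rw [mem_tabShape]
  rintro ⟨k, hk⟩
  exact (Fin.castSucc_lt_last k).ne (ht.1 hk)

/-- Branching rule for the number of standard tableaux. -/
lemma numStd_succ (r : ℕ) {D : Finset (ℕ × ℕ)} (hD : IsLowerSet (D : Set (ℕ × ℕ))) :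
    numStd (r + 1) D = ∑ d ∈ D, numStd r (D.erase d) := by
  classical
  rw [numStd, Finset.card_eq_sum_card_fiberwise (f := fun t => t.1 (Fin.last r)) (t := D)]
  · refine Finset.sum_congr rfl fun d hd => ?_
    rw [numStd]
    refine Finset.card_bij' (fun t _ => ⟨fun k => t.1 k.castSucc, t.2.init⟩)
      (fun t ht => if h : IsStd (Fin.snoc (α := fun _ => ℕ × ℕ) t.1 d) then ⟨_, h⟩ else
        Classical.choice ⟨⟨Fin.snoc (α := fun _ => ℕ × ℕ) t.1 d, t.2.snoc
          (by rw [(Finset.mem_filter.mp ht).2]; simp)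
          (fun c hc hne => by
            rw [(Finset.mem_filter.mp ht).2]; exact Finset.mem_erase.mpr ⟨hne, hD hc hd⟩)⟩⟩)
      ?_ ?_ ?_ ?_
    · intro t ht
      simp only [Finset.mem_filter, Finset.mem_univ, true_and] at ht ⊢
      rw [← ht.1, tabShape_succ, ht.2, Finset.erase_insert]
      rw [← ht.2]
      exact t.2.last_notMem
    · intro t ht
      have hs := t.2.snoc (d := d)
          (by rw [(Finset.mem_filter.mp ht).2]; simp)
          (fun c hc hne => by
            rw [(Finset.mem_filter.mp ht).2]; exact Finset.mem_erase.mpr ⟨hne, hD hc hd⟩)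
      rw [dif_pos hs]
      simp only [Finset.mem_filter, Finset.mem_univ, true_and] at ht ⊢
      rw [tabShape_succ]
      simp only [Fin.snoc_last, Fin.snoc_castSucc, ht, and_true]
      exact Finset.insert_erase hd
    · intro t ht
      simp only [Finset.mem_filter, Finset.mem_univ, true_and] at ht
      have e : Fin.snoc (α := fun _ => ℕ × ℕ) (fun k : Fin r => t.1 k.castSucc) d = t.1 := by
        rw [← ht.2]; exact Fin.snoc_init_self (α := fun _ => ℕ × ℕ) t.1
      rw [dif_pos (by rw [e]; exact t.2)]
      exact Subtype.ext e
    · intro t ht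
      have hs := t.2.snoc (d := d)
          (by rw [(Finset.mem_filter.mp ht).2]; simp)
          (fun c hc hne => by
            rw [(Finset.mem_filter.mp ht).2]; exact Finset.mem_erase.mpr ⟨hne, hD hc hd⟩)
      simp only [dif_pos hs]
      exact Subtype.ext (by funext k; simp)
  · intro t ht
    have ht' := (Finset.mem_filter.mp (Finset.mem_coe.mp ht)).2
    rw [Finset.mem_coe, ← ht']
    exact mem_tabShape.mpr ⟨_, rfl⟩

open scoped Classical in
/-- The cells that can be added to a diagram. -/
noncomputable def addable (D : Finset (ℕ × ℕ)) : Finset (ℕ × ℕ) :=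
  (insert (0, 0) (D.image (fun c => (c.1 + 1, c.2)) ∪ D.image (fun c => (c.1, c.2 + 1)))).filter
    fun c => c ∉ D ∧ IsLowerSet ((insert c D : Finset (ℕ × ℕ)) : Set (ℕ × ℕ))

open scoped Classical in
/-- The cells that can be removed from a diagram. -/
noncomputable def removable (D : Finset (ℕ × ℕ)) : Finset (ℕ × ℕ) :=
  D.filter fun d => IsLowerSet ((D.erase d : Finset (ℕ × ℕ)) : Set (ℕ × ℕ))

lemma mem_removable {D : Finset (ℕ × ℕ)} {d : ℕ × ℕ} : d ∈ removable D ↔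
    d ∈ D ∧ IsLowerSet ((D.erase d : Finset (ℕ × ℕ)) : Set (ℕ × ℕ)) := by
  simp [removable]

lemma mem_addable {D : Finset (ℕ × ℕ)} {c : ℕ × ℕ} : c ∈ addable D ↔
    c ∉ D ∧ IsLowerSet ((insert c D : Finset (ℕ × ℕ)) : Set (ℕ × ℕ)) := by
  classical
  rw [addable, Finset.mem_filter, and_iff_right_iff_imp]
  rintro ⟨hc, hl⟩
  obtain ⟨a, b⟩ := c
  have key : ∀ e : ℕ × ℕ, e ≤ (a, b) → e ≠ (a, b) → e ∈ D := fun e h1 h2 => by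
    have := hl h1 (Finset.mem_coe.mpr (Finset.mem_insert_self _ _))
    exact (Finset.mem_insert.mp (Finset.mem_coe.mp this)).resolve_left h2
  simp only [Finset.mem_insert, Finset.mem_union, Finset.mem_image]
  rcases a with _ | a
  · rcases b with _ | b
    · exact Or.inl rfl
    · exact Or.inr (Or.inr ⟨(0, b), key _ ⟨le_rfl, by simp⟩ (by simp), rfl⟩)
  · exact Or.inr (Or.inl ⟨(a, b), key _ ⟨by simp, le_rfl⟩ (by simp), rfl⟩)

/-- A Young diagram has one more addable cell than removable cells. -/
lemma card_addable {D : Finset (ℕ × ℕ)} (hD : IsLowerSet (D : Set (ℕ × ℕ))) :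
    (addable D).card = (removable D).card + 1 := by
  classical
  let μ : YoungDiagram := ⟨D, hD⟩
  have hmem : ∀ i j, (i, j) ∈ D ↔ j < μ.rowLen i := fun i j =>
    YoungDiagram.mem_iff_lt_rowLen (μ := μ)
  have hanti := μ.rowLen_anti
  let R : Finset ℕ := (removable D).image Prod.fst
  have hrem : ∀ i j, (i, j) ∈ removable D ↔ j + 1 = μ.rowLen i ∧ μ.rowLen (i + 1) ≤ j := by
    intro i j
    rw [mem_removable]
    constructor
    · rintro ⟨h1, h2⟩
      have h3 : ∀ e : ℕ × ℕ, (i, j) ≤ e → e ≠ (i, j) → e ∉ D := by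
        intro e he hne hmem
        have := h2 he (Finset.mem_coe.mpr (Finset.mem_erase.mpr ⟨hne, hmem⟩))
        simp at this
      have h4 := h3 (i, j + 1) ⟨le_rfl, by simp⟩ (by simp)
      have h5 := h3 (i + 1, j) ⟨by simp, le_rfl⟩ (by simp)
      rw [hmem] at h1 h4 h5
      omega
    · rintro ⟨h1, h2⟩
      refine ⟨(hmem _ _).mpr (by omega), ?_⟩
      rintro ⟨a, b⟩ ⟨c, d⟩ ⟨hca, hdb⟩ hab
      simp only [Finset.coe_erase, Set.mem_sdiff, Finset.mem_coe, Set.mem_singleton_iff,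
        Prod.mk.injEq, hmem] at hab hca hdb ⊢
      have := hanti _ _ hca
      refine ⟨by omega, ?_⟩
      rintro ⟨rfl, rfl⟩
      rcases hca.lt_or_eq with h | h
      · have := hanti (c + 1) a h
        omega
      · subst h
        omega
  have hadd : ∀ i j, (i, j) ∈ addable D ↔ j = μ.rowLen i ∧ (i = 0 ∨ j < μ.rowLen (i - 1)) := by
    intro i j
    rw [mem_addable]
    constructor
    · rintro ⟨h1, h2⟩
      have h3 : ∀ e : ℕ × ℕ, e ≤ (i, j) → e ≠ (i, j) → e ∈ D := by
        intro e he hne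
        have := h2 he (Finset.mem_coe.mpr (Finset.mem_insert_self _ _))
        exact (Finset.mem_insert.mp (Finset.mem_coe.mp this)).resolve_left hne
      rw [hmem] at h1
      constructor
      · rcases j with _ | j
        · omega
        · have h4 := h3 (i, j) ⟨le_rfl, by simp⟩ (by simp)
          rw [hmem] at h4
          omega
      · rcases i with _ | i
        · exact Or.inl rfl
        · have h5 := h3 (i, j) ⟨by simp, le_rfl⟩ (by simp)
          rw [hmem] at h5
          exact Or.inr h5
    · rintro ⟨h1, h2⟩
      refine ⟨by rw [hmem]; omega, ?_⟩
      rintro ⟨a, b⟩ ⟨c, d⟩ ⟨hca, hdb⟩ hab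
      simp only [Finset.coe_insert, Set.mem_insert_iff, Finset.mem_coe,
        Prod.mk.injEq, hmem] at hab hca hdb ⊢
      have := hanti _ _ hca
      rcases hab with ⟨rfl, rfl⟩ | hab
      · rcases hca.lt_or_eq with h | h
        · have := hanti c (a - 1) (by omega)
          omega
        · subst h
          omega
      · omega
  have hR : ∀ i, i ∈ R ↔ μ.rowLen (i + 1) < μ.rowLen i := by
    intro i
    simp only [R, Finset.mem_image, Prod.exists, exists_and_right, exists_eq_right, hrem]
    exact ⟨fun ⟨j, h⟩ => by omega, fun h => ⟨μ.rowLen i - 1, by omega⟩⟩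
  have hRcard : R.card = (removable D).card := by
    refine Finset.card_image_of_injOn ?_
    rintro ⟨i, j⟩ h ⟨i', j'⟩ h' e
    simp only at e
    subst e
    rw [Finset.mem_coe, hrem] at h h'
    exact Prod.ext rfl (by simp only; omega)
  have hA : (addable D).image Prod.fst = insert 0 (R.image Nat.succ) := by
    ext i
    simp only [Finset.mem_image, Finset.mem_insert, Prod.exists, exists_and_right,
      exists_eq_right, hadd, hR]
    constructor
    · rintro ⟨j, rfl, h⟩
      rcases i with _ | i
      · exact Or.inl rfl
      · exact Or.inr ⟨i, by simpa using h, rfl⟩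
    · rintro (rfl | ⟨i, h, rfl⟩)
      · exact ⟨_, rfl, Or.inl rfl⟩
      · exact ⟨_, rfl, Or.inr (by simpa using h)⟩
  have hAcard : ((addable D).image Prod.fst).card = (addable D).card := by
    refine Finset.card_image_of_injOn ?_
    rintro ⟨i, j⟩ h ⟨i', j'⟩ h' e
    simp only at e
    subst e
    rw [Finset.mem_coe, hadd] at h h'
    exact Prod.ext rfl (by simp only; omega)
  rw [← hAcard, hA, Finset.card_insert_of_notMem (by simp),
    Finset.card_image_of_injective _ Nat.succ_injective, hRcard]

lemma numStd_succ_removable (r : ℕ) {D : Finset (ℕ × ℕ)} (hD : IsLowerSet (D : Set (ℕ × ℕ))) :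
    ∑ d ∈ removable D, numStd r (D.erase d) = numStd (r + 1) D := by
  rw [numStd_succ r hD]
  refine Finset.sum_subset (fun d hd => (mem_removable.mp hd).1) fun d hd hn => ?_
  exact numStd_eq_zero fun h => hn (mem_removable.mpr ⟨hd, h⟩)

/-- The commutation relation between the up and down operators on Young's lattice, applied to
the numbers of standard tableaux. -/
lemma sum_numStd_insert (r : ℕ) {D : Finset (ℕ × ℕ)} (hD : IsLowerSet (D : Set (ℕ × ℕ)))
    (hc : D.card = r) :
    ∑ c ∈ addable D, numStd (r + 1) (insert c D) = (r + 1) * numStd r D := by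
  classical
  induction r generalizing D with
  | zero =>
    obtain rfl := Finset.card_eq_zero.mp hc
    have hA : addable ∅ = {((0, 0) : ℕ × ℕ)} := by
      ext c
      rw [mem_addable, Finset.mem_singleton]
      simp only [Finset.notMem_empty, not_false_eq_true, true_and, insert_empty_eq,
        Finset.coe_singleton]
      constructor
      · intro h
        exact (h (show ((0, 0) : ℕ × ℕ) ≤ c from ⟨Nat.zero_le _, Nat.zero_le _⟩) rfl).symm
      · rintro rfl a b hb (rfl : a = (0, 0))
        exact le_antisymm hb ⟨Nat.zero_le _, Nat.zero_le _⟩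
    rw [hA, Finset.sum_singleton, numStd_succ]
    · simp
    · have : ((0, 0) : ℕ × ℕ) ∈ addable ∅ := by rw [hA]; simp
      exact (mem_addable.mp this).2
  | succ r ih =>
    have h1 : ∀ c ∈ addable D, numStd (r + 1 + 1) (insert c D) =
        numStd (r + 1) D + ∑ d ∈ D, numStd (r + 1) ((insert c D).erase d) := by
      intro c hcA
      rw [mem_addable] at hcA
      rw [numStd_succ _ hcA.2, Finset.sum_insert hcA.1, Finset.erase_insert hcA.1]
    have h2 : ∑ c ∈ addable D, ∑ d ∈ D, numStd (r + 1) ((insert c D).erase d) =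
        ∑ d ∈ removable D, ∑ c ∈ (addable (D.erase d)).erase d,
          numStd (r + 1) (insert c (D.erase d)) := by
      have h3 : ∀ c ∈ addable D, ∑ d ∈ D, numStd (r + 1) ((insert c D).erase d) =
          ∑ d ∈ (D.filter fun d => IsLowerSet
            (((insert c D).erase d : Finset (ℕ × ℕ)) : Set (ℕ × ℕ))),
            numStd (r + 1) ((insert c D).erase d) := by
        intro c hcA
        rw [Finset.sum_filter]
        refine Finset.sum_congr rfl fun d hd => ?_
        split_ifs with h
        · rfl
        · exact numStd_eq_zero h
      have e : ∀ c d, c ∉ D → d ∈ D → (insert c D).erase d = insert c (D.erase d) := by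
        intro c d hc hd
        rw [Finset.erase_insert_of_ne]
        rintro rfl; exact hc hd
      rw [Finset.sum_congr rfl h3]
      rw [Finset.sum_comm' (t' := removable D) (s' := fun d => (addable (D.erase d)).erase d)]
      · refine Finset.sum_congr rfl fun d hd => Finset.sum_congr rfl fun c hcA => ?_
        rw [mem_removable] at hd
        simp only [Finset.mem_erase, mem_addable, not_and] at hcA
        rw [e c d (fun h => hcA.2.1 hcA.1 h) hd.1]
      · intro c d
        simp only [Finset.mem_filter, mem_addable, mem_removable, Finset.mem_erase]
        constructor
        · rintro ⟨⟨h1, h2⟩, h3, h4⟩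
          have hcd : c ≠ d := by rintro rfl; exact h1 h3
          rw [e c d h1 h3] at h4
          refine ⟨⟨hcd, fun h => h1 h.2, h4⟩, h3, ?_⟩
          have := h4.inter hD
          convert this using 1
          ext x
          simp only [Finset.coe_erase, Finset.coe_insert, Set.mem_sdiff, Finset.mem_coe,
            Set.mem_singleton_iff, Set.mem_inter_iff, Set.mem_insert_iff]
          constructor
          · tauto
          · rintro ⟨rfl | h, h'⟩
            · exact absurd h' h1
            · exact h
        · rintro ⟨⟨h1, h2, h3⟩, h4, h5⟩
          have hc : c ∉ D := fun h => h2 ⟨h1, h⟩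
          refine ⟨⟨hc, ?_⟩, h4, by rwa [e c d hc h4]⟩
          have := h3.union hD
          convert this using 1
          ext x
          simp only [Finset.coe_erase, Finset.coe_insert, Set.mem_sdiff, Finset.mem_coe,
            Set.mem_singleton_iff, Set.mem_union, Set.mem_insert_iff]
          tauto
    have h4 : ∀ d ∈ removable D, ∑ c ∈ (addable (D.erase d)).erase d,
          numStd (r + 1) (insert c (D.erase d)) + numStd (r + 1) D =
          (r + 1) * numStd r (D.erase d) := by
      intro d hd
      rw [mem_removable] at hd
      rw [← ih hd.2 (by rw [Finset.card_erase_of_mem hd.1, hc]; rfl)]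
      have hmem : d ∈ addable (D.erase d) := by
        rw [mem_addable, Finset.insert_erase hd.1]
        exact ⟨by simp, hD⟩
      rw [← Finset.sum_erase_add _ _ hmem, Finset.insert_erase hd.1]
    have h5 := Finset.sum_congr rfl h4
    rw [Finset.sum_add_distrib, ← h2, Finset.sum_const, ← Finset.mul_sum,
      numStd_succ_removable r hD] at h5
    rw [Finset.sum_congr rfl h1, Finset.sum_add_distrib, Finset.sum_const, card_addable hD]
    simp only [smul_eq_mul] at h5 ⊢
    linarith

/-- The number of pairs of standard tableaux of the same shape is `r!`. -/
theorem sum_numStd_tabShape (r : ℕ) :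
    ∑ t : StdTab r, numStd r (tabShape t.1) = r.factorial := by
  classical
  induction r with
  | zero =>
    have e : ∀ t : Fin 0 → ℕ × ℕ, IsStd t := fun t => ⟨fun i => i.elim0, fun i => i.elim0⟩
    have : Unique (StdTab 0) := ⟨⟨⟨Fin.elim0, e _⟩⟩, fun t => Subtype.ext (funext fun i => i.elim0)⟩
    simp only [numStd, Fintype.sum_unique, Nat.factorial]
    rw [Finset.card_eq_one]
    exact ⟨default, by ext t; simp [Subsingleton.elim t default]⟩
  | succ r ih =>
    rw [← Finset.sum_fiberwise (g := fun t : StdTab (r + 1) =>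
      (⟨fun k => t.1 k.castSucc, t.2.init⟩ : StdTab r))]
    rw [Nat.factorial_succ, ← ih, Finset.mul_sum]
    refine Finset.sum_congr rfl fun s _ => ?_
    rw [← sum_numStd_insert r s.2.isLowerSet_tabShape s.2.card_tabShape]
    have hs : ∀ c ∈ addable (tabShape s.1), IsStd (Fin.snoc (α := fun _ => ℕ × ℕ) s.1 c) := by
      intro c hc
      rw [mem_addable] at hc
      refine s.2.snoc hc.1 fun e he hne => ?_
      have := hc.2 he (Finset.mem_coe.mpr (Finset.mem_insert_self _ _))
      exact (Finset.mem_insert.mp (Finset.mem_coe.mp this)).resolve_left hne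
    refine Finset.sum_bij' (fun t _ => t.1 (Fin.last r)) (fun c hc => ⟨_, hs c hc⟩) ?_ ?_ ?_ ?_ ?_
    · intro t ht
      obtain rfl := (Finset.mem_filter.mp ht).2
      rw [mem_addable, ← tabShape_succ]
      exact ⟨t.2.last_notMem, t.2.isLowerSet_tabShape⟩
    · intro c hc
      simp
    · intro t ht
      obtain rfl := (Finset.mem_filter.mp ht).2
      exact Subtype.ext (Fin.snoc_init_self (α := fun _ => ℕ × ℕ) t.1)
    · intro c hc
      simp
    · intro t ht
      obtain rfl := (Finset.mem_filter.mp ht).2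
      rw [← tabShape_succ]

/-- The number of pairs of standard tableaux of the same shape is `r!`, as a cardinality. -/
theorem card_sameShape (r : ℕ) :
    Nat.card {p : StdTab r × StdTab r // tabShape p.1.1 = tabShape p.2.1} = r.factorial := by
  classical
  rw [← sum_numStd_tabShape, Nat.card_eq_fintype_card, Fintype.card_subtype,
    Finset.card_filter, Fintype.sum_prod_type]
  refine Finset.sum_congr rfl fun t _ => ?_
  rw [numStd, Finset.card_filter]
  exact Finset.sum_congr rfl fun s _ => by simp only [eq_comm]

end Counting

section OrthogonalForm

open Equiv Matrix

variable (F : Type*) [Field F] [IsAlgClosed F]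

/-- The off-diagonal coefficient `√(1 - d⁻²)` of Young's orthogonal form. -/
noncomputable def offDiag (d : ℤ) : F :=
  Classical.choose (IsAlgClosed.exists_eq_mul_self (1 - (d : F)⁻¹ ^ 2))

lemma offDiag_mul_self (d : ℤ) : offDiag F d * offDiag F d = 1 - (d : F)⁻¹ ^ 2 :=
  (Classical.choose_spec (IsAlgClosed.exists_eq_mul_self (1 - (d : F)⁻¹ ^ 2))).symm

lemma offDiag_neg (d : ℤ) : offDiag F (-d) = offDiag F d := by
  have : ∀ x y : F, x = y → Classical.choose (IsAlgClosed.exists_eq_mul_self x) =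
    Classical.choose (IsAlgClosed.exists_eq_mul_self y) := by rintro x _ rfl; rfl
  exact this _ _ (by push_cast; rw [inv_neg, neg_sq])

lemma offDiag_one : offDiag F 1 = 0 := by
  have := offDiag_mul_self F 1
  simpa using this

lemma offDiag_neg_one : offDiag F (-1) = 0 := by rw [offDiag_neg, offDiag_one]

lemma offDiag_ne_zero [CharZero F] {d : ℤ} (h1 : d ≠ 1) (h2 : d ≠ -1) : offDiag F d ≠ 0 := by
  intro h
  have := offDiag_mul_self F d
  rw [h, mul_zero, eq_comm, sub_eq_zero, eq_comm, inv_pow, inv_eq_one] at this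
  have h3 : d ^ 2 = 1 := by exact_mod_cast this
  rcases (sq_eq_sq_iff_eq_or_eq_neg.mp (h3.trans (one_pow 2).symm)) with h | h <;> contradiction

lemma axialDist_comp_self {N : ℕ} (t : Fin (N + 1) → ℕ × ℕ) (i : Fin N) :
    axialDist (t ∘ adjSwap i) i = -axialDist t i := by
  simp [axialDist, adjSwap]

lemma adjSwap_apply_of_ne {N : ℕ} {i : Fin N} {k : Fin (N + 1)} (h1 : (k : ℕ) ≠ i)
    (h2 : (k : ℕ) ≠ i + 1) : adjSwap i k = k :=
  swap_apply_of_ne_of_ne (fun e => h1 (by rw [e]; rfl)) (fun e => h2 (by rw [e]; rfl))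

lemma axialDist_comp_of_lt {N : ℕ} (t : Fin (N + 1) → ℕ × ℕ) {i j : Fin N}
    (h : (i : ℕ) + 1 < j) : axialDist (t ∘ adjSwap i) j = axialDist t j ∧
      axialDist (t ∘ adjSwap j) i = axialDist t i := by
  constructor <;> unfold axialDist <;> simp only [Function.comp_apply] <;>
  rw [adjSwap_apply_of_ne, adjSwap_apply_of_ne] <;> simp <;> omega

lemma axialDist_comp_of_succ {N : ℕ} (t : Fin (N + 1) → ℕ × ℕ) {i j : Fin N}
    (h : (i : ℕ) + 1 = j) : axialDist (t ∘ adjSwap i) j = axialDist t i + axialDist t j ∧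
      axialDist (t ∘ adjSwap j) i = axialDist t i + axialDist t j := by
  have hij : j.castSucc = i.succ := by ext; simp [h]
  constructor <;> unfold axialDist <;> simp only [Function.comp_apply]
  · rw [hij, adjSwap_apply_of_ne (k := j.succ) (by simp; omega) (by simp; omega), swap_apply_right]
    ring
  · rw [← hij, adjSwap_apply_of_ne (k := i.castSucc) (by simp; omega) (by simp; omega),
      swap_apply_left]
    ring

/-- Extension by zero of a function on standard tableaux. -/
noncomputable def extendZero {F : Type*} [Zero F] {r : ℕ} (φ : StdTab r → F)
    (t : Fin r → ℕ × ℕ) : F :=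
  open scoped Classical in if h : IsStd t then φ ⟨t, h⟩ else 0

lemma extendZero_coe {F : Type*} [Zero F] {r : ℕ} (φ : StdTab r → F) (t : StdTab r) :
    extendZero φ t.1 = φ t := by simp [extendZero, t.2]

lemma matrix_eq_of_extendZero {F : Type*} [Field F] {r : ℕ} {A B : Matrix (StdTab r) (StdTab r) F}
    (h : ∀ φ t, IsStd t → extendZero (A *ᵥ φ) t = extendZero (B *ᵥ φ) t) : A = B := by
  classical
  refine Matrix.toLin'.injective (LinearMap.ext fun φ => funext fun t => ?_)
  have := h φ t.1 t.2
  rwa [extendZero_coe, extendZero_coe] at this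

/-- Young's orthogonal form: the matrix of the adjacent transposition `adjSwap i`. -/
noncomputable def youngMatrix {N : ℕ} (i : Fin N) :
    Matrix (StdTab (N + 1)) (StdTab (N + 1)) F :=
  open scoped Classical in fun s t => (if t = s then (axialDist s.1 i : F)⁻¹ else 0) +
    (if t.1 = s.1 ∘ adjSwap i then offDiag F (axialDist s.1 i) else 0)

/-- The operator of Young's orthogonal form on functions of arbitrary fillings. -/
noncomputable def fillingOp {N : ℕ} (i : Fin N) (ψ : (Fin (N + 1) → ℕ × ℕ) → F)
    (t : Fin (N + 1) → ℕ × ℕ) : F :=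
  (axialDist t i : F)⁻¹ * ψ t + offDiag F (axialDist t i) * ψ (t ∘ adjSwap i)

lemma youngMatrix_mulVec {N : ℕ} (i : Fin N) (φ : StdTab (N + 1) → F) (s : StdTab (N + 1)) :
    (youngMatrix F i *ᵥ φ) s = fillingOp F i (extendZero φ) s.1 := by
  classical
  rw [mulVec, dotProduct, fillingOp, extendZero_coe]
  simp only [youngMatrix, add_mul, ite_mul, zero_mul, Finset.sum_add_distrib,
    Finset.sum_ite_eq', Finset.mem_univ, if_true]
  congr 1
  unfold extendZero
  split_ifs with h
  · rw [Finset.sum_eq_single ⟨_, h⟩]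
    · simp
    · intro t _ hne
      rw [if_neg fun e => hne (Subtype.ext e)]
    · simp
  · rw [mul_zero]
    refine Finset.sum_eq_zero fun t _ => ?_
    rw [if_neg fun e => h (by rw [← e]; exact t.2)]

lemma fillingOp_congr {N : ℕ} (i : Fin N) {ψ ψ' : (Fin (N + 1) → ℕ × ℕ) → F}
    (h : ∀ t, IsStd t → ψ t = ψ' t) {t : Fin (N + 1) → ℕ × ℕ} (ht : IsStd t) :
    fillingOp F i ψ t = fillingOp F i ψ' t := by
  unfold fillingOp
  rw [h t ht]
  by_cases h1 : axialDist t i = 1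
  · rw [h1, offDiag_one]; simp
  by_cases h2 : axialDist t i = -1
  · rw [h2, offDiag_neg_one]; simp
  rw [h _ (ht.comp_adjSwap i h1 h2)]

lemma extendZero_mulVec {N : ℕ} (i : Fin N) (φ : StdTab (N + 1) → F)
    (ψ : (Fin (N + 1) → ℕ × ℕ) → F) (h : ∀ t, IsStd t → extendZero φ t = ψ t)
    (t : Fin (N + 1) → ℕ × ℕ) (ht : IsStd t) :
    extendZero (youngMatrix F i *ᵥ φ) t = fillingOp F i ψ t := by
  rw [extendZero_coe _ ⟨t, ht⟩, youngMatrix_mulVec]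
  exact fillingOp_congr F i h ht

variable [CharZero F]

lemma youngMatrix_mul_self {N : ℕ} (i : Fin N) : youngMatrix F i * youngMatrix F i = 1 := by
  refine matrix_eq_of_extendZero fun φ t ht => ?_
  have h := extendZero_mulVec F i _ _ (extendZero_mulVec F i φ _ (fun _ _ => rfl)) t ht
  rw [← mulVec_mulVec, h, one_mulVec]
  simp only [fillingOp, axialDist_comp_self, offDiag_neg, Function.comp_assoc, ← Perm.coe_mul,
    adjSwap_mul_self, Perm.coe_one, Function.comp_id]
  have hb := offDiag_mul_self F (axialDist t i)
  push_cast
  rw [inv_neg]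
  linear_combination extendZero φ t * hb

lemma youngMatrix_braid {N : ℕ} (i j : Fin N) (hij : (i : ℕ) + 1 = j) :
    youngMatrix F i * youngMatrix F j * youngMatrix F i =
      youngMatrix F j * youngMatrix F i * youngMatrix F j := by
  refine matrix_eq_of_extendZero fun φ t ht => ?_
  have h1 := extendZero_mulVec F i _ _ (extendZero_mulVec F j _ _
    (extendZero_mulVec F i φ _ (fun _ _ => rfl))) t ht
  have h2 := extendZero_mulVec F j _ _ (extendZero_mulVec F i _ _
    (extendZero_mulVec F j φ _ (fun _ _ => rfl))) t ht
  rw [← mulVec_mulVec, ← mulVec_mulVec, h1, ← mulVec_mulVec, ← mulVec_mulVec, h2]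
  have hp := ht.axialDist_ne_zero i
  have hq := ht.axialDist_ne_zero j
  have hpq : axialDist t i + axialDist t j ≠ 0 := by
    intro h
    have hc : content (t i.castSucc) = content (t j.succ) := by
      have e : j.castSucc = i.succ := by ext; simp [hij]
      unfold axialDist at h
      rw [e] at h
      linarith
    have := ht.le_of_content_eq (by rw [Fin.lt_def]; simp; omega) hc
    simp at this
    omega
  have a1 := fun t : Fin (N + 1) → ℕ × ℕ => (axialDist_comp_of_succ t hij).1
  have a2 := fun t : Fin (N + 1) → ℕ × ℕ => (axialDist_comp_of_succ t hij).2
  have c1 : ∀ (t : Fin (N + 1) → ℕ × ℕ) (k : Fin N), (t ∘ adjSwap k) ∘ adjSwap k = t := by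
    intro t k
    rw [Function.comp_assoc, ← Perm.coe_mul, adjSwap_mul_self, Perm.coe_one, Function.comp_id]
  have c2 : ((t ∘ adjSwap i) ∘ adjSwap j) ∘ adjSwap i =
      ((t ∘ adjSwap j) ∘ adjSwap i) ∘ adjSwap j := by
    simp only [Function.comp_assoc, ← Perm.coe_mul]
    rw [adjSwap_braid i j hij]
  have e1 : -axialDist t i + (axialDist t i + axialDist t j) = axialDist t j := by ring
  have e2 : axialDist t i + axialDist t j + -axialDist t j = axialDist t i := by ring
  simp only [fillingOp, a1, a2, c1, c2, axialDist_comp_self, offDiag_neg, e1, e2]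
  have hbp := offDiag_mul_self F (axialDist t i)
  have hbq := offDiag_mul_self F (axialDist t j)
  generalize axialDist t i = p at *
  generalize axialDist t j = q at *
  have hp' : (p : F) ≠ 0 := by exact_mod_cast hp
  have hq' : (q : F) ≠ 0 := by exact_mod_cast hq
  have hpq' : (p + q : F) ≠ 0 := by exact_mod_cast hpq
  have hW : (p : F)⁻¹ * (q : F)⁻¹ - (p + q : F)⁻¹ * ((p : F)⁻¹ + (q : F)⁻¹) = 0 := by
    field_simp
    ring
  push_cast
  rw [inv_neg, inv_neg]
  linear_combination extendZero φ t * ((p + q : F)⁻¹ * (hbp - hbq) +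
    ((p : F)⁻¹ - (q : F)⁻¹) * hW) + extendZero φ (t ∘ adjSwap i) * offDiag F p * hW -
    extendZero φ (t ∘ adjSwap j) * offDiag F q * hW

lemma youngMatrix_comm {N : ℕ} (i j : Fin N) (hij : (i : ℕ) + 1 < j) :
    youngMatrix F i * youngMatrix F j = youngMatrix F j * youngMatrix F i := by
  refine matrix_eq_of_extendZero fun φ t ht => ?_
  have h1 := extendZero_mulVec F i _ _ (extendZero_mulVec F j φ _ (fun _ _ => rfl)) t ht
  have h2 := extendZero_mulVec F j _ _ (extendZero_mulVec F i φ _ (fun _ _ => rfl)) t ht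
  rw [← mulVec_mulVec, h1, ← mulVec_mulVec, h2]
  simp only [fillingOp, (axialDist_comp_of_lt _ hij).1, (axialDist_comp_of_lt _ hij).2,
    Function.comp_assoc, ← Perm.coe_mul, adjSwap_comm i j hij]
  ring

/-- Young's orthogonal form exists as a homomorphism from the symmetric group. -/
lemma exists_youngHom (N : ℕ) : ∃ σ : Perm (Fin (N + 1)) →*
    Matrix (StdTab (N + 1)) (StdTab (N + 1)) F, ∀ i, σ (adjSwap i) = youngMatrix F i :=
  exists_perm_hom _ (youngMatrix_mul_self F) (youngMatrix_braid F) (youngMatrix_comm F)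

/-- The Jucys-Murphy recursion for the diagonal matrices of contents. -/
lemma youngMatrix_jucysMurphy {N : ℕ} [DecidableEq (StdTab (N + 1))] (i : Fin N) :
    youngMatrix F i * diagonal (fun t : StdTab (N + 1) => (content (t.1 i.castSucc) : F)) *
      youngMatrix F i + youngMatrix F i =
      diagonal fun t : StdTab (N + 1) => (content (t.1 i.succ) : F) := by
  refine matrix_eq_of_extendZero fun φ t ht => ?_
  have hd : ∀ (φ : StdTab (N + 1) → F) (k) (t), IsStd t →
      extendZero (diagonal (fun t : StdTab (N + 1) => (content (t.1 k) : F)) *ᵥ φ) t =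
      content (t k) * extendZero φ t := by
    intro φ k t ht
    rw [extendZero_coe _ ⟨t, ht⟩, extendZero_coe _ ⟨t, ht⟩, mulVec_diagonal]
  have h2 := extendZero_mulVec F i φ _ (fun _ _ => rfl)
  have h1 := extendZero_mulVec F i (diagonal (fun t : StdTab (N + 1) =>
    (content (t.1 i.castSucc) : F)) *ᵥ youngMatrix F i *ᵥ φ)
    (fun t => content (t i.castSucc) * fillingOp F i (extendZero φ) t)
    (fun t ht => by rw [hd _ _ _ ht, h2 t ht]) t ht
  have hadd : ∀ φ ψ : StdTab (N + 1) → F, extendZero (φ + ψ) t =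
      extendZero φ t + extendZero ψ t := by
    intro φ ψ
    rw [extendZero_coe _ ⟨t, ht⟩, extendZero_coe _ ⟨t, ht⟩, extendZero_coe _ ⟨t, ht⟩]
    rfl
  rw [add_mulVec, hadd, ← mulVec_mulVec, ← mulVec_mulVec, h1, h2 t ht, hd _ _ _ ht]
  simp only [fillingOp, axialDist_comp_self, offDiag_neg, Function.comp_assoc, ← Perm.coe_mul,
    adjSwap_mul_self, Perm.coe_one, Function.comp_id, Function.comp_apply, swap_apply_left]
  have hb := offDiag_mul_self F (axialDist t i)
  have hp : (axialDist t i : F) ≠ 0 := by exact_mod_cast ht.axialDist_ne_zero i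
  have hy : (content (t i.succ) : F) = axialDist t i + content (t i.castSucc) := by
    rw [axialDist]; push_cast; ring
  rw [hy]
  generalize axialDist t i = p at *
  push_cast
  rw [inv_neg]
  have hpp : (p : F) * (p : F)⁻¹ = 1 := mul_inv_cancel₀ hp
  linear_combination extendZero φ t * (p + content (t i.castSucc) : F) * hb -
    (extendZero φ t * (p : F)⁻¹ + offDiag F p * extendZero φ (t ∘ adjSwap i)) * hpp

end OrthogonalForm

section MatrixUnits

open Equiv Matrix

/-- A subalgebra of functions on a finite type separating points contains all indicators. -/
lemma Subalgebra.piSingle_mem_of_separates {F ι : Type*} [Field F] [Fintype ι] [DecidableEq ι]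
    (A : Subalgebra F (ι → F)) (h : ∀ s t, s ≠ t → ∃ f ∈ A, f s ≠ f t) (t : ι) :
    Pi.single t 1 ∈ A := by
  choose! f hf hne using fun s (hs : s ≠ t) => h s t hs
  have key : (Pi.single t 1 : ι → F) = ∏ s ∈ Finset.univ.erase t,
      (f s t - f s s)⁻¹ • (f s - algebraMap F (ι → F) (f s s)) := by
    ext u
    rw [Finset.prod_apply]
    by_cases hu : u = t
    · subst hu
      rw [Pi.single_eq_same, Finset.prod_eq_one]
      intro s hs
      have := sub_ne_zero.mpr (hne s (Finset.ne_of_mem_erase hs)).symm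
      simp [inv_mul_cancel₀ this]
    · rw [Pi.single_eq_of_ne hu, Finset.prod_eq_zero (i := u)]
      · simp [hu]
      · simp
  rw [key]
  refine A.prod_mem fun s hs => A.smul_mem (A.sub_mem (hf s (Finset.ne_of_mem_erase hs)) ?_) _
  exact A.algebraMap_mem _

variable {F : Type*} [Field F] [IsAlgClosed F] [CharZero F] {N : ℕ}

lemma diagonal_content_mem [DecidableEq (StdTab (N + 1))]
    (B : Subalgebra F (Matrix (StdTab (N + 1)) (StdTab (N + 1)) F))
    (hB : ∀ i, youngMatrix F i ∈ B) (k : Fin (N + 1)) :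
    diagonal (fun t : StdTab (N + 1) => (content (t.1 k) : F)) ∈ B := by
  induction k using Fin.induction with
  | zero =>
    convert B.zero_mem
    rw [← diagonal_zero]
    congr 1
    ext t
    have := t.2.bounds 0
    simp only [Fin.val_zero] at this
    simp only [content]
    norm_num
    rw [sub_eq_zero]
    norm_cast
    omega
  | succ i ih =>
    rw [← youngMatrix_jucysMurphy]
    exact B.add_mem (B.mul_mem (B.mul_mem (hB i) ih) (hB i)) (hB i)

lemma single_self_mem [DecidableEq (StdTab (N + 1))]
    (B : Subalgebra F (Matrix (StdTab (N + 1)) (StdTab (N + 1)) F))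
    (hB : ∀ i, youngMatrix F i ∈ B) (t : StdTab (N + 1)) : single t t (1 : F) ∈ B := by
  have := (B.comap (diagonalAlgHom F)).piSingle_mem_of_separates ?_ t
  · rw [← diagonal_single]
    exact this
  · intro s u hsu
    by_contra! hcon
    refine hsu (Subtype.ext (s.2.eq_of_content_eq u.2 fun k => ?_))
    have := hcon _ (diagonal_content_mem B hB k)
    exact_mod_cast this

lemma single_mem_of_shape_eq [DecidableEq (StdTab (N + 1))]
    (B : Subalgebra F (Matrix (StdTab (N + 1)) (StdTab (N + 1)) F))
    (hB : ∀ i, youngMatrix F i ∈ B) {s t : StdTab (N + 1)} (hst : tabShape s.1 = tabShape t.1) :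
    single s t (1 : F) ∈ B := by
  have hmul : ∀ s t u : StdTab (N + 1), single s t (1 : F) ∈ B → single t u (1 : F) ∈ B →
      single s u (1 : F) ∈ B := by
    intro s t u h1 h2
    simpa using B.mul_mem h1 h2
  have hadj : ∀ (s t : StdTab (N + 1)) (i : Fin N), t.1 = s.1 ∘ adjSwap i →
      axialDist s.1 i ≠ 1 → axialDist s.1 i ≠ -1 → single s t (1 : F) ∈ B := by
    intro s t i hst h1 h2
    have hne : t ≠ s := by
      rintro rfl
      have := congrFun hst i.castSucc
      rw [Function.comp_apply, swap_apply_left] at this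
      exact Fin.castSucc_lt_succ.ne (t.2.1 this)
    have h := B.smul_mem (B.mul_mem (B.mul_mem (single_self_mem B hB s) (hB i))
      (single_self_mem B hB t)) (offDiag F (axialDist s.1 i))⁻¹
    rw [single_mul_mul_single, smul_single] at h
    convert h using 2
    simp [youngMatrix, hne, hst, inv_mul_cancel₀ (offDiag_ne_zero F h1 h2)]
  refine (StdTab.rel_of_shape_eq (fun s t : StdTab (N + 1) => single s t (1 : F) ∈ B ∧
    single t s (1 : F) ∈ B) (fun s => ⟨single_self_mem B hB s, single_self_mem B hB s⟩)
    (fun s t h => h.symm) (fun s t u h1 h2 => ⟨hmul _ _ _ h1.1 h2.1, hmul _ _ _ h2.2 h1.2⟩)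
    (fun s t i h1 h2 h => ⟨hadj s t i h h1 h2, hadj t s i ?_ ?_ ?_⟩) hst).1
  · rw [h, Function.comp_assoc, ← Perm.coe_mul, adjSwap_mul_self, Perm.coe_one, Function.comp_id]
  · rw [h, axialDist_comp_self]; omega
  · rw [h, axialDist_comp_self]; omega

variable (F N) in
/-- Matrix units of the group algebra of the symmetric group, in Young's orthogonal form. -/
theorem exists_matrixUnits : ∃ (σ : Perm (Fin (N + 1)) →*
    Matrix (StdTab (N + 1)) (StdTab (N + 1)) F)
    (e : StdTab (N + 1) → StdTab (N + 1) → MonoidAlgebra F (Perm (Fin (N + 1)))),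
    (∀ i, σ (adjSwap i) = youngMatrix F i) ∧
    Function.Injective (MonoidAlgebra.lift F _ _ σ) ∧
    (∀ s t, tabShape s.1 = tabShape t.1 → MonoidAlgebra.lift F _ _ σ (e s t) = single s t 1) ∧
    Submodule.span F (Set.range fun p : {p : StdTab (N + 1) × StdTab (N + 1) //
      tabShape p.1.1 = tabShape p.2.1} => e p.1.1 p.1.2) = ⊤ := by
  obtain ⟨σ, hσ⟩ := exists_youngHom F N
  set ρ := MonoidAlgebra.lift F (Matrix (StdTab (N + 1)) (StdTab (N + 1)) F) _ σ with hρ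
  have hmem : ∀ i, youngMatrix F i ∈ ρ.range := fun i =>
    ⟨MonoidAlgebra.of F _ (adjSwap i), by simp [hρ, hσ]⟩
  have hex : ∀ s t : StdTab (N + 1), ∃ x, tabShape s.1 = tabShape t.1 → ρ x = single s t 1 := by
    intro s t
    by_cases h : tabShape s.1 = tabShape t.1
    · obtain ⟨x, hx⟩ := single_mem_of_shape_eq ρ.range hmem h
      exact ⟨x, fun _ => hx⟩
    · exact ⟨0, fun h' => absurd h' h⟩
  choose e he using hex
  set v := fun p : {p : StdTab (N + 1) × StdTab (N + 1) //
      tabShape p.1.1 = tabShape p.2.1} => e p.1.1 p.1.2 with hv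
  have hli' : LinearIndependent F (ρ.toLinearMap ∘ v) := by
    have h1 := (Matrix.stdBasis F (StdTab (N + 1)) (StdTab (N + 1))).linearIndependent.comp
      (Subtype.val : {p : StdTab (N + 1) × StdTab (N + 1) //
      tabShape p.1.1 = tabShape p.2.1} → _) Subtype.val_injective
    convert h1 using 1
    ext1 p
    obtain ⟨⟨s, t⟩, hst⟩ := p
    simp only [Function.comp_apply, hv, AlgHom.toLinearMap_apply, he _ _ hst]
    exact (Matrix.stdBasis_eq_single F s t).symm
  have hli : LinearIndependent F v := hli'.of_comp _
  have hspan : Submodule.span F (Set.range v) = ⊤ := by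
    refine hli.span_eq_top_of_card_eq_finrank' ?_
    rw [← Nat.card_eq_fintype_card, card_sameShape]
    have : Module.finrank F (MonoidAlgebra F (Perm (Fin (N + 1)))) = _ :=
      Module.finrank_eq_card_basis (MonoidAlgebra.basis _ F)
    rw [this, Fintype.card_perm, Fintype.card_fin]
  refine ⟨σ, e, hσ, ?_, he, hspan⟩
  let b := Module.Basis.mk hli hspan.ge
  rw [injective_iff_map_eq_zero]
  intro x hx
  have hx' := b.sum_repr x
  rw [← hx', map_sum] at hx
  have h0 := (Fintype.linearIndependent_iff.mp hli') (fun i => b.repr x i) (by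
    rw [← hx]
    refine Finset.sum_congr rfl fun p _ => ?_
    rw [map_smul, Function.comp_apply, Module.Basis.mk_apply]
    rfl)
  rw [← hx']
  exact Finset.sum_eq_zero fun p _ => by rw [h0 p, zero_smul]

/-- The dimension of a homomorphic image of an algebra with block matrix units. -/
theorem finrank_range_of_matrixUnits {F ι κ A B : Type*} [Field F] [Fintype ι] [DecidableEq ι]
    [Ring A] [Algebra F A] [Ring B] [Algebra F B] (shape : ι → κ) (e : ι → ι → A)
    (hmul : ∀ x y z w, shape x = shape y → shape z = shape w →
      e x y * e z w = if y = z then e x w else 0)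
    (hspan : Submodule.span F (Set.range fun p : {p : ι × ι // shape p.1 = shape p.2} =>
      e p.1.1 p.1.2) = ⊤) (θ : A →ₐ[F] B) :
    Module.finrank F θ.range =
      Nat.card {p : ι × ι // shape p.1 = shape p.2 ∧ θ (e p.1 p.1) ≠ 0} := by
  classical
  set v := fun p : {p : ι × ι // shape p.1 = shape p.2 ∧ θ (e p.1 p.1) ≠ 0} =>
    θ (e p.1.1 p.1.2) with hv
  have hli : LinearIndependent F v := by
    rw [Fintype.linearIndependent_iff]
    rintro c hc ⟨⟨x, y⟩, hxy, hne⟩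
    have h1 : ∑ p, c p • (θ (e x x) * v p * θ (e y x)) = 0 := by
      have := congrArg (fun z => θ (e x x) * z * θ (e y x)) hc
      simpa [Finset.mul_sum, Finset.sum_mul] using this
    rw [Finset.sum_eq_single ⟨(x, y), hxy, hne⟩] at h1
    · simp only [hv, ← map_mul] at h1
      rw [hmul _ _ _ _ rfl hxy, if_pos rfl, hmul _ _ _ _ hxy hxy.symm, if_pos rfl] at h1
      exact (smul_eq_zero.mp h1).resolve_right hne
    · rintro ⟨⟨u, w⟩, huw, hne'⟩ - hne2
      simp only [hv, ← map_mul]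
      rw [hmul _ _ _ _ rfl huw]
      split_ifs with h
      · subst h
        rw [hmul _ _ _ _ huw hxy.symm, if_neg, map_zero, smul_zero]
        rintro rfl
        exact hne2 rfl
      · simp
    · simp
  have hspan' : Subalgebra.toSubmodule θ.range = Submodule.span F (Set.range v) := by
    have : Subalgebra.toSubmodule θ.range = Submodule.map θ.toLinearMap ⊤ := by
      ext; simp
    rw [this, ← hspan, Submodule.map_span]
    apply le_antisymm
    · rw [Submodule.span_le]
      rintro _ ⟨_, ⟨⟨⟨x, y⟩, hxy⟩, rfl⟩, rfl⟩
      by_cases h : θ (e x x) = 0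
      · have := hmul x x x y rfl hxy
        rw [if_pos rfl] at this
        have h0 : θ.toLinearMap (e x y) = 0 := by
          rw [AlgHom.toLinearMap_apply, ← this, map_mul, h, zero_mul]
        simp only [h0]
        exact Submodule.zero_mem _
      · exact Submodule.subset_span ⟨⟨(x, y), hxy, h⟩, rfl⟩
    · refine Submodule.span_mono ?_
      rintro _ ⟨⟨⟨x, y⟩, hxy, h⟩, rfl⟩
      exact ⟨_, ⟨⟨(x, y), hxy⟩, rfl⟩, rfl⟩
  rw [← Subalgebra.finrank_toSubmodule, hspan', finrank_span_eq_card hli,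
    Nat.card_eq_fintype_card]

end MatrixUnits

section HookNecessity

open Equiv

lemma lt_of_eq_of_step {N : ℕ} {α : Type*} [PartialOrder α] {w : Fin (N + 1) → α}
    (hw : Monotone w) {f : Fin (N + 1) → ℕ}
    (h : ∀ i : Fin N, w i.castSucc = w i.succ → f i.castSucc < f i.succ) {k l : Fin (N + 1)}
    (hkl : k < l) (he : w k = w l) : f k < f l := by
  induction l using Fin.induction with
  | zero => exact absurd hkl (Fin.not_lt_zero _)
  | succ i ih =>
    have hle : k ≤ i.castSucc := Fin.le_castSucc_iff.mpr hkl
    have he' : w i.castSucc = w i.succ :=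
      le_antisymm (hw Fin.castSucc_lt_succ.le) (he ▸ hw hle)
    rcases hle.eq_or_lt with rfl | hlt
    · exact h i he'
    · exact (ih hlt (he.trans he'.symm)).trans (h i he')

/-- Semistandardness of a sorted word along a standard tableau forces the hook condition. -/
lemma IsStd.corner_notMem {m n N : ℕ} {t : Fin (N + 1) → ℕ × ℕ} (ht : IsStd t)
    {w : Fin (N + 1) → Fin (m + n)} (hw : Monotone w)
    (h : ∀ i : Fin N, w i.castSucc = w i.succ →
      if (w i.castSucc : ℕ) < m then (t i.castSucc).2 < (t i.succ).2
      else (t i.castSucc).1 < (t i.succ).1) : (m, n) ∉ tabShape t := by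
  intro hmn
  have hlow := ht.isLowerSet_tabShape
  have hex : ∀ c ≤ (m, n), ∃ k, t k = c := fun c hc => mem_tabShape.mp (hlow hc hmn)
  set f : Fin (N + 1) → ℕ := fun k => if (w k : ℕ) < m then (t k).2 else (t k).1 with hf
  have hstep : ∀ i : Fin N, w i.castSucc = w i.succ → f i.castSucc < f i.succ := by
    intro i hi
    have := h i hi
    simp only [hf, ← hi]
    split_ifs at this ⊢ <;> exact this
  have hinj : ∀ k l, w k = w l → f k = f l → k = l := by
    intro k l hkl hfe
    rcases lt_trichotomy k l with hlt | heq | hlt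
    · exact absurd hfe (lt_of_eq_of_step hw hstep hlt hkl).ne
    · exact heq
    · exact absurd hfe (lt_of_eq_of_step hw hstep hlt hkl.symm).ne'
  have hminus : ∀ k, ∀ j ≤ n, t k = (m, j) → m ≤ (w k : ℕ) := by
    intro k j hj hk
    by_contra! hlt
    choose q hq using fun a : Fin (m + 1) => hex ((a : ℕ), j) ⟨by simp; omega, hj⟩
    have hle : ∀ a, (w (q a) : ℕ) < m := by
      intro a
      refine lt_of_le_of_lt (hw (ht.le_of_le (j := k) ?_)) hlt
      rw [hq, hk]
      exact ⟨by simp; omega, le_rfl⟩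
    have := Fintype.card_le_of_injective (fun a => (⟨w (q a), hle a⟩ : Fin m)) (by
      intro a b hab
      have hab' : w (q a) = w (q b) := Fin.ext (by simpa using hab)
      have e := hinj _ _ hab' (by simp [hf, hle, hq])
      have := hq a
      rw [e, hq b] at this
      exact Fin.ext (by simpa using this.symm))
    simp at this
  choose q hq using fun a : Fin (n + 1) => hex (m, (a : ℕ)) ⟨le_rfl, by simp; omega⟩
  have hge : ∀ a, m ≤ (w (q a) : ℕ) := fun a => hminus _ a (by omega) (hq a)
  have := Fintype.card_le_of_injective (fun a => (⟨w (q a) - m, by have := hge a; omega⟩ : Fin n)) (by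
    intro a b hab
    have hab' : w (q a) = w (q b) := Fin.ext (by
      have := hge a
      have := hge b
      simp at hab; omega)
    have e := hinj _ _ hab' (by simp [hf, (hge _).not_gt, hq])
    have := hq a
    rw [e, hq b] at this
    exact Fin.ext (by simpa using this.symm))
  simp at this

/-- A family of vectors indexed by standard tableaux which transforms according to Young's
orthogonal form and the characters of the blocks of a sorted word vanishes off the hook. -/
lemma corner_notMem_of_equivariant {F V : Type*} [Field F] [IsAlgClosed F] [CharZero F]
    [AddCommGroup V] [Module F V] {m n N : ℕ} {w : Fin (N + 1) → Fin (m + n)} (hw : Monotone w)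
    (φ : StdTab (N + 1) → V) {D : Finset (ℕ × ℕ)}
    (h : ∀ (i : Fin N) (s t : StdTab (N + 1)), w i.castSucc = w i.succ → tabShape s.1 = D →
      t.1 = s.1 ∘ adjSwap i → (if (w i.castSucc : ℕ) < m then (1 : F) else -1) • φ s =
        (axialDist s.1 i : F)⁻¹ • φ s + offDiag F (axialDist s.1 i) • φ t)
    (h' : ∀ (i : Fin N) (s : StdTab (N + 1)), w i.castSucc = w i.succ → tabShape s.1 = D →
      axialDist s.1 i = 1 ∨ axialDist s.1 i = -1 →
      (if (w i.castSucc : ℕ) < m then (1 : F) else -1) • φ s = (axialDist s.1 i : F)⁻¹ • φ s)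
    {s : StdTab (N + 1)} (hs : tabShape s.1 = D) (hne : φ s ≠ 0) : (m, n) ∉ D := by
  let key (u : StdTab (N + 1)) (k : Fin (N + 1)) : ℕ :=
    if (w k : ℕ) < m then (u.1 k).2 else (u.1 k).1
  obtain ⟨u, hu, hmax⟩ := Set.exists_max_image
    {u : StdTab (N + 1) | tabShape u.1 = D ∧ φ u ≠ 0}
    (fun u => ∑ k : Fin (N + 1), (k : ℕ) * key u k) (Set.toFinite _) ⟨s, hs, hne⟩
  rw [← hu.1]
  have hne1 : (1 : F) ≠ -1 := by
    intro h
    have : (2 : F) = 0 := by linear_combination h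
    exact two_ne_zero this
  refine u.2.corner_notMem hw fun i hi => ?_
  by_cases h1 : axialDist u.1 i = 1
  · have e := h' i u hi hu.1 (Or.inl h1)
    have hc := u.2.of_axialDist_eq_one i h1
    split_ifs at e ⊢ with hlt
    · unfold axialDist content at h1
      omega
    · rw [h1, Int.cast_one, inv_one] at e
      exact absurd (smul_left_injective F hu.2 e) hne1.symm
  by_cases h2 : axialDist u.1 i = -1
  · have e := h' i u hi hu.1 (Or.inr h2)
    have hc := u.2.of_axialDist_eq_neg_one i h2
    split_ifs at e ⊢ with hlt
    · rw [h2, Int.cast_neg, Int.cast_one, inv_neg, inv_one] at e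
      exact absurd (smul_left_injective F hu.2 e) hne1
    · unfold axialDist content at h2
      omega
  have ht := u.2.comp_adjSwap i h1 h2
  have e := h i u ⟨_, ht⟩ hi hu.1 rfl
  have hφ : φ ⟨_, ht⟩ ≠ 0 := by
    intro h0
    rw [h0, smul_zero, add_zero] at e
    have e' := smul_left_injective F hu.2 e
    split_ifs at e'
    · rw [eq_comm, inv_eq_one] at e'
      exact h1 (by exact_mod_cast e')
    · rw [eq_comm, inv_eq_iff_eq_inv, inv_neg, inv_one] at e'
      exact h2 (by exact_mod_cast e')
  have hle : key u i.castSucc ≤ key u i.succ := by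
    by_contra! hlt
    have hlt' := sum_mul_comp_adjSwap _ i hlt
    refine absurd (hmax ⟨_, ht⟩ ⟨by rw [tabShape_comp_perm, hu.1], hφ⟩) ?_
    have hw' : ∀ k, w (adjSwap i k) = w k := by
      intro k
      rw [adjSwap, swap_apply_def]
      split_ifs with h3 h4
      · rw [h3, hi]
      · rw [h4, hi]
      · rfl
    have hk : key ⟨_, ht⟩ = key u ∘ adjSwap i := by
      ext k
      simp [key, hw']
    rw [hk]
    exact hlt'.not_ge
  simp only [key, ← hi] at hle
  split_ifs at hle ⊢
  · refine lt_of_le_of_ne hle fun hcol => h2 (u.2.axialDist_of_col i hcol.symm)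
  · refine lt_of_le_of_ne hle fun hrow => h1 (u.2.axialDist_of_row i hrow.symm)

end HookNecessity

section SignedAction

open Equiv

lemma sgn_comm (R : Type*) [CommRing R] (m : ℕ) {M : ℕ} (k l : Fin M) :
    sgn R m k l = sgn R m l k := by
  rw [sgn, sgn, mul_comm]

lemma sgn_mul_self (R : Type*) [CommRing R] (m : ℕ) {M : ℕ} (k l : Fin M) :
    sgn R m k l * sgn R m k l = 1 := by
  rw [sgn, ← mul_pow]
  simp

lemma sgn_self (R : Type*) [CommRing R] (m : ℕ) {M : ℕ} (k : Fin M) :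
    sgn R m k k = if (k : ℕ) < m then 1 else -1 := by
  unfold sgn deg
  split_ifs <;> simp

variable (F : Type*) [Field F] (m : ℕ) {M N : ℕ}

/-- The signed swap of neighbouring tensor factors, on functions of words. -/
def signedSwap (i : Fin N) : Module.End F ((Fin (N + 1) → Fin M) → F) where
  toFun φ b := sgn F m (b i.castSucc) (b i.succ) * φ (b ∘ adjSwap i)
  map_add' φ ψ := by ext b; simp [mul_add]
  map_smul' c φ := by ext b; simp [mul_left_comm]

lemma signedSwap_apply (i : Fin N) (φ : (Fin (N + 1) → Fin M) → F) (b : Fin (N + 1) → Fin M) :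
    signedSwap F m i φ b = sgn F m (b i.castSucc) (b i.succ) * φ (b ∘ adjSwap i) := rfl

lemma comp_adjSwap_comp_adjSwap {α : Type*} (b : Fin (N + 1) → α) (i : Fin N) :
    (b ∘ adjSwap i) ∘ adjSwap i = b := by
  rw [Function.comp_assoc, ← Perm.coe_mul, adjSwap_mul_self, Perm.coe_one, Function.comp_id]

lemma swapOp_apply (i : Fin N) (a b : Fin (N + 1) → Fin M) :
    swapOp F m (N + 1) i (Nat.succ_lt_succ i.2) a b =
      if a = b ∘ adjSwap i then sgn F m (b i.castSucc) (b i.succ) else 0 := by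
  have e1 : (⟨i, Nat.lt_of_succ_lt (Nat.succ_lt_succ i.2)⟩ : Fin (N + 1)) = i.castSucc := rfl
  have e2 : (⟨i + 1, Nat.succ_lt_succ i.2⟩ : Fin (N + 1)) = i.succ := rfl
  unfold swapOp twoSiteOp Pent
  rw [e1, e2]
  split_ifs with h1 h2 h2
  · rw [Prod.mk.injEq] at h1
    rw [Finset.prod_eq_one, ← h1.1, ← h1.2, sgn_comm]
    · simp only [mul_one]
    · intro j hj
      simp at hj
      rw [h2, Function.comp_apply, adjSwap, swap_apply_of_ne_of_ne hj.1 hj.2, if_pos rfl]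
  · rw [Prod.mk.injEq] at h1
    suffices ∃ j, ¬ (j = i.castSucc ∨ j = i.succ) ∧ a j ≠ b j by
      obtain ⟨j, hj, hne⟩ := this
      rw [Finset.prod_eq_zero (i := j), mul_zero]
      · simpa using hj
      · rw [if_neg hne]
    by_contra! hcon
    refine h2 (funext fun k => ?_)
    rw [Function.comp_apply, adjSwap, swap_apply_def]
    split_ifs with h3 h4
    · rw [h3]; exact h1.2.symm
    · rw [h4]; exact h1.1.symm
    · exact hcon k (by tauto)
  · refine absurd ?_ h1
    rw [h2]
    simp [adjSwap]
  · simp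

lemma vecMulLinear_swapOp (i : Fin N) :
    Matrix.vecMulLinear (swapOp F m (N := M) (N + 1) i (Nat.succ_lt_succ i.2)) =
      signedSwap F m i := by
  refine LinearMap.ext fun φ => funext fun b => ?_
  rw [Matrix.vecMulLinear_apply, Matrix.vecMul, dotProduct, signedSwap_apply]
  simp only [swapOp_apply, mul_ite, mul_zero, Finset.sum_ite_eq', Finset.mem_univ, if_true]
  rw [mul_comm]

lemma vecMulLinear_image_swapGens :
    (Matrix.vecMulLinear '' swapGens F m (N := M) (N + 1) :
      Set (Module.End F ((Fin (N + 1) → Fin M) → F))) =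
      Set.range fun i : Fin N => signedSwap F m i := by
  ext x
  constructor
  · rintro ⟨_, ⟨i, hi, rfl⟩, rfl⟩
    exact ⟨⟨i, Nat.lt_of_succ_lt_succ hi⟩, (vecMulLinear_swapOp F m _).symm⟩
  · rintro ⟨i, rfl⟩
    exact ⟨_, ⟨i, Nat.succ_lt_succ i.2, rfl⟩, vecMulLinear_swapOp F m i⟩

lemma exists_signedHom (M N : ℕ) : ∃ θ : Perm (Fin (N + 1)) →*
    Module.End F ((Fin (N + 1) → Fin M) → F), ∀ i, θ (adjSwap i) = signedSwap F m i := by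
  refine exists_perm_hom _ (fun i => ?_) (fun i j hij => ?_) (fun i j hij => ?_)
  · refine LinearMap.ext fun φ => funext fun b => ?_
    simp only [Module.End.mul_apply, signedSwap_apply, comp_adjSwap_comp_adjSwap,
      Function.comp_apply, swap_apply_left, swap_apply_right, Module.End.one_apply]
    rw [← mul_assoc, sgn_comm F m (b i.succ), sgn_mul_self, one_mul]
  · have e : j.castSucc = i.succ := by ext; simp [hij]
    have e1 : adjSwap i j.succ = j.succ := adjSwap_apply_of_ne (by simp; omega) (by simp; omega)
    have e2 : adjSwap j i.castSucc = i.castSucc :=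
      adjSwap_apply_of_ne (by simp; omega) (by simp; omega)
    have e3 : adjSwap i i.succ = i.castSucc := swap_apply_right _ _
    have e4 : adjSwap i i.castSucc = i.succ := swap_apply_left _ _
    have e5 : adjSwap j i.succ = j.succ := by rw [← e]; exact swap_apply_left _ _
    have e6 : adjSwap j j.succ = i.succ := by rw [← e]; exact swap_apply_right _ _
    refine LinearMap.ext fun φ => funext fun b => ?_
    have c2 : ((b ∘ adjSwap i) ∘ adjSwap j) ∘ adjSwap i =
      ((b ∘ adjSwap j) ∘ adjSwap i) ∘ adjSwap j := by
      simp only [Function.comp_assoc, ← Perm.coe_mul]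
      rw [adjSwap_braid i j hij]
    simp only [Module.End.mul_apply, signedSwap_apply, c2, Function.comp_apply, e, e1, e2, e3, e4,
      e5, e6]
    ring
  · refine LinearMap.ext fun φ => funext fun b => ?_
    have e1 : adjSwap i j.succ = j.succ := adjSwap_apply_of_ne (by simp; omega) (by simp; omega)
    have e2 : adjSwap i j.castSucc = j.castSucc :=
      adjSwap_apply_of_ne (by simp; omega) (by simp; omega)
    have e3 : adjSwap j i.succ = i.succ := adjSwap_apply_of_ne (by simp; omega) (by simp; omega)
    have e4 : adjSwap j i.castSucc = i.castSucc :=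
      adjSwap_apply_of_ne (by simp; omega) (by simp; omega)
    simp only [Module.End.mul_apply, signedSwap_apply, Function.comp_apply, e1, e2, e3, e4,
      Function.comp_assoc, ← Perm.coe_mul, adjSwap_comm i j hij]
    ring

lemma signedSwap_single (i : Fin N) (w : Fin (N + 1) → Fin M) :
    signedSwap F m i (Pi.single w 1) =
      sgn F m (w i.castSucc) (w i.succ) • Pi.single (w ∘ adjSwap i) 1 := by
  ext b
  rw [signedSwap_apply, Pi.smul_apply, Pi.single_apply, Pi.single_apply, smul_eq_mul]
  have : b ∘ adjSwap i = w ↔ b = w ∘ adjSwap i := by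
    constructor <;> rintro rfl <;> rw [comp_adjSwap_comp_adjSwap]
  simp only [this]
  split_ifs with h
  · subst h
    simp [adjSwap, sgn_comm]
  · simp

variable {F m} {θ : Perm (Fin (N + 1)) →* Module.End F ((Fin (N + 1) → Fin M) → F)}

lemma adjSwap_induction {p : Perm (Fin (N + 1)) → Prop} (h1 : p 1)
    (hmul : ∀ i g, p g → p (adjSwap i * g)) (g : Perm (Fin (N + 1))) : p g := by
  have : g ∈ Submonoid.closure (Set.range fun i : Fin N => adjSwap i) := by
    rw [Equiv.Perm.mclosure_swap_castSucc_succ]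
    trivial
  induction this using Submonoid.closure_induction_left with
  | one => exact h1
  | mul_left x hx y hy ih =>
    obtain ⟨i, rfl⟩ := hx
    exact hmul i y ih

lemma signedHom_single (hθ : ∀ i, θ (adjSwap i) = signedSwap F m i) (g : Perm (Fin (N + 1)))
    (w : Fin (N + 1) → Fin M) :
    ∃ c : F, c ≠ 0 ∧ θ g (Pi.single w 1) = c • Pi.single (w ∘ (g⁻¹ : Perm _)) 1 := by
  induction g using adjSwap_induction with
  | h1 => exact ⟨1, one_ne_zero, by simp⟩
  | hmul i g ih =>
    obtain ⟨c, hc, e⟩ := ih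
    refine ⟨c * sgn F m ((w ∘ (g⁻¹ : Perm _)) i.castSucc) ((w ∘ (g⁻¹ : Perm _)) i.succ),
      mul_ne_zero hc (left_ne_zero_of_mul_eq_one (sgn_mul_self ..)), ?_⟩
    rw [map_mul, Module.End.mul_apply, e, map_smul, hθ, signedSwap_single, smul_smul,
      Function.comp_assoc, ← Perm.coe_mul, mul_inv_rev, swap_inv]

lemma adjoin_signedSwap (hθ : ∀ i, θ (adjSwap i) = signedSwap F m i) :
    Algebra.adjoin F (Set.range fun i : Fin N => signedSwap F m i) =
      (MonoidAlgebra.lift F (Module.End F ((Fin (N + 1) → Fin M) → F)) _ θ).range := by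
  apply le_antisymm
  · rw [Algebra.adjoin_le_iff]
    rintro _ ⟨i, rfl⟩
    exact ⟨MonoidAlgebra.of F _ (adjSwap i), by simp [hθ]⟩
  · rintro _ ⟨x, rfl⟩
    change MonoidAlgebra.lift F _ _ θ x ∈ _
    rw [MonoidAlgebra.lift_apply]
    refine Subalgebra.sum_mem _ fun g hg => Subalgebra.smul_mem _ ?_ _
    clear hg
    induction g using adjSwap_induction with
    | h1 => rw [map_one]; exact Subalgebra.one_mem _
    | hmul i g ih =>
      rw [map_mul, hθ]
      exact Subalgebra.mul_mem _ (Algebra.subset_adjoin ⟨i, rfl⟩) ih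

end SignedAction

section Necessity

open Equiv Matrix

variable {F : Type*} [Field F] {N : ℕ}
  {σ : Perm (Fin (N + 1)) →* Matrix (StdTab (N + 1)) (StdTab (N + 1)) F}
  {e : StdTab (N + 1) → StdTab (N + 1) → MonoidAlgebra F (Perm (Fin (N + 1)))}

lemma matrixUnits_mul (hinj : Function.Injective (MonoidAlgebra.lift F _ _ σ))
    (he : ∀ s t, tabShape s.1 = tabShape t.1 → MonoidAlgebra.lift F _ _ σ (e s t) = single s t 1)
    {x y z w : StdTab (N + 1)} (hxy : tabShape x.1 = tabShape y.1)
    (hzw : tabShape z.1 = tabShape w.1) : e x y * e z w = if y = z then e x w else 0 := by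
  apply hinj
  rw [map_mul, he _ _ hxy, he _ _ hzw]
  split_ifs with h
  · subst h
    rw [he _ _ (hxy.trans hzw), single_mul_single_same, one_mul]
  · rw [map_zero, single_mul_single_of_ne _ _ _ _ h]

variable [IsAlgClosed F]

lemma single_mul_youngMatrix (i : Fin N) (s t u : StdTab (N + 1)) (hu : u.1 = t.1 ∘ adjSwap i) :
    single s t (1 : F) * youngMatrix F i = (axialDist t.1 i : F)⁻¹ • single s t 1 +
      offDiag F (axialDist t.1 i) • single s u 1 := by
  ext a b
  have hb : b.1 = t.1 ∘ adjSwap i ↔ u = b := by rw [← hu, Subtype.ext_iff, eq_comm]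
  rw [Matrix.add_apply, Matrix.smul_apply, Matrix.smul_apply]
  by_cases ha : a = s
  · subst ha
    rw [single_mul_apply_same]
    simp [youngMatrix, hb, single_apply, eq_comm]
  · rw [single_mul_apply_of_ne _ _ _ _ _ ha]
    simp [Ne.symm ha]

lemma single_mul_youngMatrix_of_adjacent (i : Fin N) (s t : StdTab (N + 1))
    (h : axialDist t.1 i = 1 ∨ axialDist t.1 i = -1) :
    single s t (1 : F) * youngMatrix F i = (axialDist t.1 i : F)⁻¹ • single s t 1 := by
  have h0 : offDiag F (axialDist t.1 i) = 0 := by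
    rcases h with h | h <;> rw [h]
    · exact offDiag_one F
    · exact offDiag_neg_one F
  ext a b
  rw [Matrix.smul_apply]
  by_cases ha : a = s
  · subst ha
    rw [single_mul_apply_same]
    simp [youngMatrix, h0, single_apply, eq_comm]
  · rw [single_mul_apply_of_ne _ _ _ _ _ ha]
    simp [Ne.symm ha]

variable [CharZero F] {m n : ℕ}
  {θ : Perm (Fin (N + 1)) →* Module.End F ((Fin (N + 1) → Fin (m + n)) → F)}

/-- A matrix unit acting nontrivially on words has a shape inside the hook. -/
theorem corner_notMem_of_apply_ne_zero (hσ : ∀ i, σ (adjSwap i) = youngMatrix F i)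
    (hinj : Function.Injective (MonoidAlgebra.lift F _ _ σ))
    (he : ∀ s t, tabShape s.1 = tabShape t.1 → MonoidAlgebra.lift F _ _ σ (e s t) = single s t 1)
    (hspan : Submodule.span F (Set.range fun p : {p : StdTab (N + 1) × StdTab (N + 1) //
      tabShape p.1.1 = tabShape p.2.1} => e p.1.1 p.1.2) = ⊤)
    (hθ : ∀ i, θ (adjSwap i) = signedSwap F m i) {t : StdTab (N + 1)}
    (ht : MonoidAlgebra.lift F _ _ θ (e t t) ≠ 0) : (m, n) ∉ tabShape t.1 := by
  set Θ := MonoidAlgebra.lift F (Module.End F ((Fin (N + 1) → Fin (m + n)) → F)) _ θ with hΘ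
  have hΘof : ∀ g, Θ (MonoidAlgebra.of F _ g) = θ g := fun g => by simp [hΘ]
  obtain ⟨w₀, hw₀⟩ : ∃ w₀, Θ (e t t) (Pi.single w₀ 1) ≠ 0 := by
    by_contra! hcon
    refine ht ((Pi.basisFun F _).ext fun w => ?_)
    rw [Pi.basisFun_apply, hcon, LinearMap.zero_apply]
  set g := Tuple.sort w₀
  set w := w₀ ∘ g with hw
  have hmono : Monotone w := Tuple.monotone_sort w₀
  obtain ⟨c, hc, hcw⟩ := signedHom_single hθ g w
  have hww : w ∘ (g⁻¹ : Perm _) = w₀ := by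
    rw [hw, Function.comp_assoc, ← Perm.coe_mul, mul_inv_cancel, Perm.coe_one, Function.comp_id]
  have hne : Θ (e t t * MonoidAlgebra.of F _ g) (Pi.single w 1) ≠ 0 := by
    rw [map_mul, Module.End.mul_apply, hΘof, hcw, hww, map_smul]
    exact smul_ne_zero hc hw₀
  obtain ⟨s, hs, hsne⟩ : ∃ s, tabShape s.1 = tabShape t.1 ∧ Θ (e t s) (Pi.single w 1) ≠ 0 := by
    by_contra! hcon
    refine hne ?_
    have hx : MonoidAlgebra.of F _ g ∈ Submodule.span F (Set.range fun p :
      {p : StdTab (N + 1) × StdTab (N + 1) // tabShape p.1.1 = tabShape p.2.1} =>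
        e p.1.1 p.1.2) := hspan ▸ trivial
    generalize MonoidAlgebra.of F _ g = x at hx ⊢
    induction hx using Submodule.span_induction with
    | mem x hx =>
      obtain ⟨⟨⟨u, v⟩, huv⟩, rfl⟩ := hx
      rw [matrixUnits_mul hinj he rfl huv]
      split_ifs with h
      · subst h
        exact hcon v huv.symm
      · simp
    | zero => simp
    | add x y _ _ hx hy => rw [mul_add, map_add, LinearMap.add_apply, hx, hy, add_zero]
    | smul a x _ hx => rw [mul_smul_comm, map_smul, LinearMap.smul_apply, hx, smul_zero]
  have hε : ∀ (i : Fin N) (u : StdTab (N + 1)), w i.castSucc = w i.succ →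
      (if (w i.castSucc : ℕ) < m then (1 : F) else -1) • Θ (e t u) (Pi.single w 1) =
        Θ (e t u * MonoidAlgebra.of F _ (adjSwap i)) (Pi.single w 1) := by
    intro i u hi
    have hwi : w ∘ adjSwap i = w := by
      ext1 k
      rw [Function.comp_apply, adjSwap, swap_apply_def]
      split_ifs with h3 h4
      · rw [h3, hi]
      · rw [h4, hi]
      · rfl
    rw [map_mul, Module.End.mul_apply, hΘof, hθ, signedSwap_single, hwi, ← hi, sgn_self, map_smul]
  refine corner_notMem_of_equivariant (F := F) hmono (fun u => Θ (e t u) (Pi.single w 1))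
    (fun i u v hi hu huv => ?_) (fun i u hi hu hd => ?_) hs hsne
  · have hv : tabShape v.1 = tabShape t.1 := by rw [huv, tabShape_comp_perm, hu]
    rw [hε i u hi]
    have : e t u * MonoidAlgebra.of F _ (adjSwap i) = (axialDist u.1 i : F)⁻¹ • e t u +
        offDiag F (axialDist u.1 i) • e t v := by
      apply hinj
      rw [map_mul, map_add, map_smul, map_smul, he _ _ hu.symm, he _ _ hv.symm,
        MonoidAlgebra.lift_of, hσ, single_mul_youngMatrix i t u v huv]
    rw [this, map_add, map_smul, map_smul]
    rfl
  · rw [hε i u hi]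
    have : e t u * MonoidAlgebra.of F _ (adjSwap i) = (axialDist u.1 i : F)⁻¹ • e t u := by
      apply hinj
      rw [map_mul, map_smul, he _ _ hu.symm,
        MonoidAlgebra.lift_of, hσ, single_mul_youngMatrix_of_adjacent i t u hd]
    rw [this, map_smul]
    rfl

end Necessity

section Sufficiency

open Equiv Matrix

/-- The sorting key of a cell: rows `< m` come first, one after the other, then the columns of
the remaining cells. -/
def hookKey (m : ℕ) (c : ℕ × ℕ) : ℕ ×ₗ ℕ :=
  if c.1 < m then toLex (c.1, c.2) else toLex (m + c.2, c.1)

lemma hookKey_mono (m : ℕ) : Monotone (hookKey m) := by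
  rintro ⟨a, b⟩ ⟨c, d⟩ ⟨h1, h2⟩
  simp only at h1 h2
  unfold hookKey
  split_ifs <;> simp only [Prod.Lex.toLex_le_toLex] <;> simp at * <;> omega

lemma hookKey_injective (m : ℕ) : Function.Injective (hookKey m) := by
  rintro ⟨a, b⟩ ⟨c, d⟩ h
  unfold hookKey at h
  split_ifs at h <;> simp at * <;> omega

/-- Every shape inside the hook carries a tableau filled block by block. -/
lemma exists_blockTableau {m n N : ℕ} (t : StdTab (N + 1)) (h : (m, n) ∉ tabShape t.1) :
    ∃ (u : StdTab (N + 1)) (w : Fin (N + 1) → Fin (m + n)), tabShape u.1 = tabShape t.1 ∧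
      Monotone w ∧ ∀ i : Fin N, w i.castSucc = w i.succ →
        axialDist u.1 i = if (w i.castSucc : ℕ) < m then 1 else -1 := by
  set g := Tuple.sort (hookKey m ∘ t.1)
  set u := t.1 ∘ g with hu
  have hmono : Monotone (hookKey m ∘ u) := Tuple.monotone_sort (hookKey m ∘ t.1)
  have hinj : Function.Injective u := t.2.1.comp g.injective
  have hshape : tabShape u = tabShape t.1 := tabShape_comp_perm _ _
  have hstrict : StrictMono (hookKey m ∘ u) :=
    hmono.strictMono_of_injective ((hookKey_injective m).comp hinj)
  have hstd : IsStd u := by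
    refine ⟨hinj, fun k c hc => ?_⟩
    have hcD : c ∈ tabShape u := by
      rw [hshape]
      exact t.2.isLowerSet_tabShape hc (hshape ▸ mem_tabShape.mpr ⟨k, rfl⟩)
    obtain ⟨j, rfl⟩ := mem_tabShape.mp hcD
    exact ⟨j, hstrict.le_iff_le.mp (hookKey_mono m hc), rfl⟩
  have hlt : ∀ k, (ofLex (hookKey m (u k))).1 < m + n := by
    intro k
    unfold hookKey
    split_ifs with hk
    · simp; omega
    · simp only [ofLex_toLex, add_lt_add_iff_left]
      by_contra! hcon
      refine h (t.2.isLowerSet_tabShape (a := u k) ⟨?_, hcon⟩ (hshape ▸ mem_tabShape.mpr ⟨k, rfl⟩))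
      simp only; omega
  refine ⟨⟨u, hstd⟩, fun k => ⟨_, hlt k⟩, hshape, fun k l hkl => ?_, fun i hi => ?_⟩
  · have := hmono hkl
    rw [Prod.Lex.le_iff] at this
    rw [Fin.mk_le_mk]
    exact this.elim le_of_lt fun h => h.1.le
  · simp only [Fin.mk.injEq] at hi ⊢
    by_cases h1 : (u i.castSucc).1 < m <;> by_cases h2 : (u i.succ).1 < m <;>
      simp [hookKey, h1, h2] at hi ⊢
    · exact hstd.axialDist_of_row i hi.symm
    · omega
    · omega
    · exact hstd.axialDist_of_col i hi.symm

lemma eq_one_of_le_succ {N : ℕ} {g : Perm (Fin (N + 1))}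
    (h : ∀ i : Fin N, g i.castSucc ≤ g i.succ) : g = 1 := by
  have hg : StrictMono g := Fin.strictMono_iff_lt_succ.mpr fun i =>
    lt_of_le_of_ne (h i) (g.injective.ne Fin.castSucc_lt_succ.ne)
  exact Equiv.ext (congrFun ((StrictMono.range_inj hg strictMono_id).mp (by simp)))

lemma stabilizer_induction {N : ℕ} {α : Type*} [PartialOrder α] {w : Fin (N + 1) → α}
    (hw : Monotone w) {p : Perm (Fin (N + 1)) → Prop} (h1 : p 1)
    (hmul : ∀ (i : Fin N) g, w i.castSucc = w i.succ → p g → p (g * adjSwap i))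
    (g : Perm (Fin (N + 1))) (hg : w ∘ g = w) : p g := by
  by_contra hpg
  obtain ⟨u, ⟨hu, hpu⟩, hmax⟩ := Set.exists_max_image
    {g : Perm (Fin (N + 1)) | w ∘ g = w ∧ ¬ p g}
    (fun g => ∑ k : Fin (N + 1), (k : ℕ) * (g k : ℕ)) (Set.toFinite _) ⟨g, hg, hpg⟩
  have hne : u ≠ 1 := fun h => hpu (h ▸ h1)
  obtain ⟨i, hi⟩ : ∃ i : Fin N, u i.succ < u i.castSucc := by
    by_contra! hcon
    exact hne (eq_one_of_le_succ hcon)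
  have hwi : w i.castSucc = w i.succ := by
    refine le_antisymm (hw Fin.castSucc_lt_succ.le) ?_
    have := hw hi.le
    rwa [← Function.comp_apply (f := w), ← Function.comp_apply (f := w), hu] at this
  have hwi' : w ∘ adjSwap i = w := by
    ext1 k
    rw [Function.comp_apply, adjSwap, swap_apply_def]
    split_ifs with h3 h4
    · rw [h3, hwi]
    · rw [h4, hwi]
    · rfl
  have hlt := sum_mul_comp_adjSwap (fun k => (u k : ℕ)) i hi
  refine hlt.not_ge (hmax (u * adjSwap i) ⟨?_, fun hp => hpu ?_⟩)
  · rw [Perm.coe_mul, ← Function.comp_assoc, hu, hwi']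
  · have := hmul i _ hwi hp
    rwa [mul_assoc, adjSwap_mul_self, mul_one] at this

variable {F : Type*} [Field F] [IsAlgClosed F] {N m n : ℕ}

lemma youngMatrix_mulVec_single_of_adjacent (i : Fin N) (t : StdTab (N + 1))
    (h : axialDist t.1 i = 1 ∨ axialDist t.1 i = -1) :
    youngMatrix F i *ᵥ Pi.single t 1 = (axialDist t.1 i : F) • Pi.single t 1 := by
  ext s
  rw [mulVec_single_one, Pi.smul_apply, col_apply, youngMatrix, Pi.single_apply]
  have h2 : (if t.1 = s.1 ∘ adjSwap i then offDiag F (axialDist s.1 i) else 0) = 0 := by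
    split_ifs with hs
    · rw [hs, axialDist_comp_self] at h
      rcases h with h | h
      · rw [← offDiag_neg, h, offDiag_one]
      · rw [← offDiag_neg, h, offDiag_neg_one]
    · rfl
  rw [h2, add_zero]
  by_cases hs : s = t
  · subst hs
    rcases h with h | h <;> simp [h, inv_neg]
  · simp [hs, Ne.symm hs]

variable {σ : Perm (Fin (N + 1)) →* Matrix (StdTab (N + 1)) (StdTab (N + 1)) F}
  {e : StdTab (N + 1) → StdTab (N + 1) → MonoidAlgebra F (Perm (Fin (N + 1)))}
  {θ : Perm (Fin (N + 1)) →* Module.End F ((Fin (N + 1) → Fin (m + n)) → F)}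

lemma exists_sign_of_stabilizer (hσ : ∀ i, σ (adjSwap i) = youngMatrix F i)
    (hθ : ∀ i, θ (adjSwap i) = signedSwap F m i) {w : Fin (N + 1) → Fin (m + n)}
    (hw : Monotone w) {u : StdTab (N + 1)} (hu : ∀ i : Fin N, w i.castSucc = w i.succ →
      axialDist u.1 i = if (w i.castSucc : ℕ) < m then 1 else -1)
    (g : Perm (Fin (N + 1))) (hg : w ∘ g = w) : ∃ c : F, c * c = 1 ∧
      θ g (Pi.single w 1) = c • Pi.single w 1 ∧
      σ g *ᵥ Pi.single u 1 = c • Pi.single u 1 := by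
  refine stabilizer_induction (p := fun g => ∃ c : F, c * c = 1 ∧
    θ g (Pi.single w 1) = c • Pi.single w 1 ∧ σ g *ᵥ Pi.single u 1 = c • Pi.single u 1) hw
    ⟨1, one_mul 1, by simp, by rw [map_one, one_mulVec, one_smul]⟩ (fun i g hi ih => ?_) g hg
  · obtain ⟨c, hc, h1, h2⟩ := ih
    have hwi : w ∘ adjSwap i = w := by
      ext1 k
      rw [Function.comp_apply, adjSwap, swap_apply_def]
      split_ifs with h3 h4
      · rw [h3, hi]
      · rw [h4, hi]
      · rfl
    have hd := hu i hi
    refine ⟨(if (w i.castSucc : ℕ) < m then 1 else -1) * c, ?_, ?_, ?_⟩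
    · split_ifs <;> simp [hc]
    · rw [map_mul, Module.End.mul_apply, hθ, signedSwap_single, hwi, ← hi, sgn_self, map_smul,
        h1, smul_smul]
    · rw [map_mul, ← mulVec_mulVec, hσ, youngMatrix_mulVec_single_of_adjacent, hd, mulVec_smul, h2,
        smul_smul]
      · split_ifs <;> simp
      · rw [hd]
        split_ifs <;> simp

variable [CharZero F]

/-- A matrix unit whose shape lies inside the hook acts nontrivially on words. -/
theorem apply_ne_zero_of_corner_notMem (hσ : ∀ i, σ (adjSwap i) = youngMatrix F i)
    (hinj : Function.Injective (MonoidAlgebra.lift F _ _ σ))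
    (he : ∀ s t, tabShape s.1 = tabShape t.1 → MonoidAlgebra.lift F _ _ σ (e s t) = single s t 1)
    (hθ : ∀ i, θ (adjSwap i) = signedSwap F m i) {t : StdTab (N + 1)}
    (ht : (m, n) ∉ tabShape t.1) : MonoidAlgebra.lift F _ _ θ (e t t) ≠ 0 := by
  obtain ⟨u, w, hut, hw, hu⟩ := exists_blockTableau t ht
  intro h0
  have hu0 : MonoidAlgebra.lift F _ _ θ (e u u) = 0 := by
    have : e u u = e u t * e t t * e t u := by
      rw [matrixUnits_mul hinj he hut rfl, if_pos rfl, matrixUnits_mul hinj he hut hut.symm,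
        if_pos rfl]
    rw [this, map_mul, map_mul, h0, mul_zero, zero_mul]
  let v : StdTab (N + 1) → F := Pi.single u 1
  let Φ : ((Fin (N + 1) → Fin (m + n)) → F) →ₗ[F] (StdTab (N + 1) → F) :=
    ∑ g : Perm (Fin (N + 1)), (LinearMap.proj w ∘ₗ θ g⁻¹).smulRight (σ g *ᵥ v)
  have hΦ : ∀ φ, Φ φ = ∑ g : Perm (Fin (N + 1)), (θ g⁻¹ φ w) • (σ g *ᵥ v) := by
    intro φ
    simp [Φ, LinearMap.sum_apply]
  have hΦg : ∀ h φ, Φ (θ h φ) = σ h *ᵥ Φ φ := by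
    intro h φ
    rw [hΦ, hΦ, mulVec_sum, ← Equiv.sum_comp (Equiv.mulLeft h)]
    refine Finset.sum_congr rfl fun g _ => ?_
    rw [Equiv.coe_mulLeft, mulVec_smul, map_mul, mulVec_mulVec, ← Module.End.mul_apply, ← map_mul,
      _root_.mul_inv_rev, inv_mul_cancel_right]
  have hΦx : ∀ x φ, Φ (MonoidAlgebra.lift F _ _ θ x φ) = MonoidAlgebra.lift F _ _ σ x *ᵥ Φ φ := by
    intro x φ
    induction x using MonoidAlgebra.induction_on with
    | of g => rw [MonoidAlgebra.lift_of, MonoidAlgebra.lift_of, hΦg]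
    | add x y hx hy => rw [map_add, map_add, LinearMap.add_apply, map_add, hx, hy, add_mulVec]
    | smul c x hx => rw [map_smul, map_smul, LinearMap.smul_apply, map_smul, hx, smul_mulVec]
  classical
  have hΦw : Φ (Pi.single w 1) =
      ((Finset.univ.filter fun g : Perm (Fin (N + 1)) => w ∘ g = w).card : F) • v := by
    rw [hΦ, Finset.cast_card, Finset.sum_smul, Finset.sum_filter]
    refine Finset.sum_congr rfl fun g _ => ?_
    split_ifs with hg
    · obtain ⟨c, hc, h1, h2⟩ := exists_sign_of_stabilizer hσ hθ hw hu g hg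
      have h3 : θ g⁻¹ (Pi.single w 1) = c • Pi.single w 1 := by
        have := congrArg (fun z => c • θ g⁻¹ z) h1
        simp only [← Module.End.mul_apply, ← map_mul, map_smul, smul_smul, hc] at this
        simpa using this.symm
      rw [h2, h3, smul_smul, Pi.smul_apply, Pi.single_eq_same, smul_eq_mul, mul_one, hc]
    · obtain ⟨c, -, hc⟩ := signedHom_single hθ g⁻¹ w
      rw [hc, Pi.smul_apply, inv_inv, Pi.single_eq_of_ne (Ne.symm hg), smul_zero, zero_smul]
  have hfin := hΦx (e u u) (Pi.single w 1)
  rw [hu0, LinearMap.zero_apply, map_zero, hΦw, he u u rfl, mulVec_smul] at hfin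
  have hv : single u u (1 : F) *ᵥ v = v := by
    ext s
    simp [v, single_apply, Pi.single_apply, eq_comm]
  rw [hv, eq_comm, smul_eq_zero, Nat.cast_eq_zero, Finset.card_eq_zero] at hfin
  rcases hfin with h | h
  · rw [Finset.filter_eq_empty_iff] at h
    exact h (Finset.mem_univ 1) rfl
  · have := congrFun h u
    simp [v] at this

end Sufficiency

section Partitions

lemma cellIn_of_le {r : ℕ} {lam : Nat.Partition r} {c d : ℕ × ℕ} (hcd : c ≤ d)
    (hd : cellIn lam d) : cellIn lam c := by
  refine lt_of_le_of_lt hcd.1 (lt_of_lt_of_le hd ?_)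
  exact Multiset.card_le_card (Multiset.monotone_filter_right _ fun _ h => hcd.2.trans_lt h)

lemma partition_ext_of_cellIn {r : ℕ} {lam mu : Nat.Partition r}
    (h : ∀ c, cellIn lam c ↔ cellIn mu c) : lam = mu := by
  have hcard : ∀ j, (lam.parts.filter fun p => j < p).card =
      (mu.parts.filter fun p => j < p).card := by
    intro j
    refine le_antisymm ?_ ?_ <;> by_contra! hlt
    · exact lt_irrefl _ ((h (_, j)).mp hlt)
    · exact lt_irrefl _ ((h (_, j)).mpr hlt)
  have hcount : ∀ (nu : Nat.Partition r) (a : ℕ), (nu.parts.filter fun p => a < p).card =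
      (nu.parts.filter fun p => a + 1 < p).card + nu.parts.count (a + 1) := by
    intro nu a
    rw [← Multiset.countP_eq_card_filter, ← Multiset.countP_eq_card_filter, Multiset.count]
    induction nu.parts using Multiset.induction_on with
    | empty => simp
    | cons b s ih =>
      simp only [Multiset.countP_cons, ih]
      split_ifs <;> omega
  refine Nat.Partition.ext (Multiset.ext.mpr fun a => ?_)
  rcases a with - | a
  · rw [Multiset.count_eq_zero_of_notMem fun h0 => (lam.parts_pos h0).ne rfl,
      Multiset.count_eq_zero_of_notMem fun h0 => (mu.parts_pos h0).ne rfl]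
  · have h1 := hcount lam a
    have h2 := hcount mu a
    rw [hcard, hcard] at h1
    omega

lemma exists_partition_of_isLowerSet {r : ℕ} {D : Finset (ℕ × ℕ)}
    (hD : IsLowerSet (D : Set (ℕ × ℕ))) (hcard : D.card = r) :
    ∃ lam : Nat.Partition r, ∀ c, c ∈ D ↔ cellIn lam c := by
  let Y : YoungDiagram := ⟨D, hD⟩
  have hY : ∀ c, c ∈ D ↔ c ∈ Y := fun c => Iff.rfl
  have hcol : ∀ j, Y.colLen j ≤ r := by
    intro j
    rw [YoungDiagram.colLen_eq_card, ← hcard]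
    exact Finset.card_le_card (Finset.filter_subset _ _)
  have hsum : ((Multiset.range r).map Y.rowLen).sum = r := by
    change ∑ a ∈ Finset.range r, Y.rowLen a = r
    have := Finset.card_eq_sum_card_fiberwise (s := D) (t := Finset.range r) (f := Prod.fst) (by
      rintro ⟨a, b⟩ h
      have h' := YoungDiagram.mem_iff_lt_colLen.mp ((hY _).mp h)
      simpa using h'.trans_le (hcol b))
    refine Eq.trans ?_ (this.symm.trans hcard)
    refine Finset.sum_congr rfl fun a _ => ?_
    rw [YoungDiagram.rowLen_eq_card]
    rfl
  refine ⟨Nat.Partition.ofSums r _ hsum, fun ⟨i, j⟩ => ?_⟩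
  have hfil : (((Nat.Partition.ofSums r _ hsum).parts.filter fun p => j < p).card) =
      Y.colLen j := by
    rw [Nat.Partition.ofSums_parts, Multiset.filter_filter]
    have : Multiset.filter (fun a => j < a ∧ a ≠ 0) (Multiset.map Y.rowLen (Multiset.range r)) =
        Multiset.filter (fun a => j < a) (Multiset.map Y.rowLen (Multiset.range r)) :=
      Multiset.filter_congr fun a _ => ⟨fun h => h.1, fun h => ⟨h, by omega⟩⟩
    rw [this, Multiset.filter_map, Multiset.card_map]
    change (Finset.filter ((fun a => j < a) ∘ Y.rowLen) (Finset.range r)).card = _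
    have : Finset.filter ((fun a => j < a) ∘ Y.rowLen) (Finset.range r) =
        Finset.range (Y.colLen j) := by
      ext a
      simp only [Finset.mem_filter, Finset.mem_range, Function.comp_apply,
        ← YoungDiagram.mem_iff_lt_rowLen, YoungDiagram.mem_iff_lt_colLen]
      have := hcol j
      omega
    rw [this, Finset.card_range]
  rw [hY, YoungDiagram.mem_iff_lt_colLen, cellIn, hfil]

lemma fSYT_eq_card {r : ℕ} (lam : Nat.Partition r) :
    fSYT lam = Nat.card {t : StdTab r // ∀ c, c ∈ tabShape t.1 ↔ cellIn lam c} := by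
  let f : {t : StdTab r // ∀ c, c ∈ tabShape t.1 ↔ cellIn lam c} →
      {c : ℕ × ℕ // cellIn lam c} → Fin r :=
    fun t c => Classical.choose (mem_tabShape.mp ((t.2 c.1).mpr c.2))
  have hf : ∀ (t : {t : StdTab r // ∀ c, c ∈ tabShape t.1 ↔ cellIn lam c})
      (c : {c : ℕ × ℕ // cellIn lam c}), t.1.1 (f t c) = c.1 := fun t c =>
    Classical.choose_spec (mem_tabShape.mp ((t.2 c.1).mpr c.2))
  have hlt : ∀ (t : {t : StdTab r // ∀ c, c ∈ tabShape t.1 ↔ cellIn lam c})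
      (c d : {c : ℕ × ℕ // cellIn lam c}), c.1 ≤ d.1 → c ≠ d → f t c < f t d := by
    intro t c d hcd hne
    refine lt_of_le_of_ne (t.1.2.le_of_le (by rwa [hf, hf])) fun e => hne (Subtype.ext ?_)
    rw [← hf t c, e, hf]
  have hbij : ∀ t : {t : StdTab r // ∀ c, c ∈ tabShape t.1 ↔ cellIn lam c},
      Function.Bijective (f t) := by
    intro t
    refine ⟨fun c d h => Subtype.ext (by rw [← hf t c, h, hf]), fun k => ?_⟩
    refine ⟨⟨t.1.1 k, (t.2 _).mp (mem_tabShape.mpr ⟨k, rfl⟩)⟩, t.1.2.1 (hf _ _)⟩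
  symm
  refine Nat.card_eq_of_bijective (fun t => ⟨f t, hbij t, fun c d h1 h2 => hlt t c d ?_ ?_,
    fun c d h1 h2 => hlt t c d ?_ ?_⟩) ⟨?_, ?_⟩
  · exact ⟨h1.le, h2.le⟩
  · rintro rfl; exact lt_irrefl _ h2
  · exact ⟨h2.le, h1.le⟩
  · rintro rfl; exact lt_irrefl _ h2
  · intro s t hst
    have hst' : f s = f t := congrArg Subtype.val hst
    refine Subtype.ext (Subtype.ext (funext fun k => ?_))
    obtain ⟨c, rfl⟩ := (hbij s).2 k
    rw [hf, hst', hf]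
  · rintro ⟨g, hg, hrow, hcol⟩
    let E := Equiv.ofBijective g hg
    have hmono : ∀ c d, c.1 ≤ d.1 → g c ≤ g d := by
      rintro ⟨⟨a, b⟩, hc⟩ ⟨⟨a', b'⟩, hd⟩ ⟨h1, h2⟩
      simp only at h1 h2
      have hmid : cellIn lam (a, b') :=
        cellIn_of_le (d := (a', b')) (Prod.mk_le_mk.mpr ⟨h1, le_rfl⟩) hd
      have e1 : g ⟨(a, b), hc⟩ ≤ g ⟨(a, b'), hmid⟩ := by
        rcases h2.eq_or_lt with rfl | h2
        · exact le_rfl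
        · exact (hrow ⟨(a, b), hc⟩ ⟨(a, b'), hmid⟩ rfl h2).le
      refine e1.trans ?_
      rcases h1.eq_or_lt with rfl | h1
      · exact le_rfl
      · exact (hcol ⟨(a, b'), hmid⟩ ⟨(a', b'), hd⟩ rfl h1).le
    let t : Fin r → ℕ × ℕ := fun k => (E.symm k).1
    have ht : IsStd t := by
      refine ⟨Subtype.val_injective.comp E.symm.injective, fun k c hc => ?_⟩
      refine ⟨g ⟨c, cellIn_of_le hc (E.symm k).2⟩, ?_, ?_⟩
      · have := hmono ⟨c, cellIn_of_le hc (E.symm k).2⟩ (E.symm k) hc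
        rwa [show g (E.symm k) = k from E.apply_symm_apply k] at this
      · change (E.symm (E _)).1 = c
        rw [E.symm_apply_apply]
    have htD : ∀ c, c ∈ tabShape t ↔ cellIn lam c := by
      intro c
      rw [mem_tabShape]
      constructor
      · rintro ⟨k, rfl⟩
        exact (E.symm k).2
      · intro hc
        refine ⟨g ⟨c, hc⟩, ?_⟩
        change (E.symm (E _)).1 = c
        rw [E.symm_apply_apply]
    refine ⟨⟨⟨t, ht⟩, htD⟩, Subtype.ext (funext fun c => ht.1 ?_)⟩
    refine (hf ⟨⟨t, ht⟩, htD⟩ c).trans ?_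
    change c.1 = (E.symm (E _)).1
    rw [E.symm_apply_apply]

theorem sum_fSYT_sq (m n r : ℕ) : ∑ lam ∈ hookFinset m n r, fSYT lam ^ 2 =
    Nat.card {p : StdTab r × StdTab r //
      tabShape p.1.1 = tabShape p.2.1 ∧ (m, n) ∉ tabShape p.1.1} := by
  classical
  choose sh hsh using fun t : StdTab r =>
    exists_partition_of_isLowerSet t.2.isLowerSet_tabShape t.2.card_tabShape
  have hsh' : ∀ (t : StdTab r) lam, (∀ c, c ∈ tabShape t.1 ↔ cellIn lam c) ↔ sh t = lam := by
    intro t lam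
    constructor
    · exact fun h => partition_ext_of_cellIn fun c => (hsh t c).symm.trans (h c)
    · rintro rfl
      exact hsh t
  have heq : ∀ s t : StdTab r, tabShape s.1 = tabShape t.1 ↔ sh s = sh t := by
    intro s t
    rw [← hsh', Finset.ext_iff]
    simp only [hsh t]
  have hhook : ∀ t : StdTab r, (m, n) ∉ tabShape t.1 ↔ sh t ∈ hookFinset m n r := by
    intro t
    rw [hsh, cellIn, hookFinset, Finset.mem_filter, not_lt]
    simp
  rw [Nat.card_eq_fintype_card, Fintype.card_subtype,
    Finset.card_eq_sum_card_fiberwise (f := fun p => sh p.1) (t := hookFinset m n r)]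
  · refine Finset.sum_congr rfl fun lam hlam => ?_
    rw [fSYT_eq_card, Nat.card_eq_fintype_card, Fintype.card_subtype, sq, ← Finset.card_product]
    congr 1
    ext ⟨s, t⟩
    simp only [Finset.mem_product, Finset.mem_filter, Finset.mem_univ, true_and, hsh', heq, hhook]
    constructor
    · rintro ⟨rfl, h⟩
      exact ⟨⟨h.symm, hlam⟩, rfl⟩
    · rintro ⟨⟨h, -⟩, rfl⟩
      exact ⟨rfl, h.symm⟩
  · intro p hp
    simp only [Finset.coe_filter, Finset.mem_univ, true_and, Set.mem_ofPred_eq] at hp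
    exact (hhook _).mp hp.2

end Partitions

/-- the Hook Theorem of Berele–Regev. Over an algebraically closed
field `F` of characteristic `0`, the `F`-dimension of the subalgebra of
`End_F(W^{⊗ r})` generated by the signed swap operators `P_1, …, P_{r−1}` (the image of
`F[𝔖_r]` under the sign permutation representation) equals
`Σ_{λ ∈ H(m,n;r)} (f^λ)²`. -/
theorem hook_theorem (F : Type*) [Field F] [IsAlgClosed F] [CharZero F]
    (m n r : ℕ) (hm : 1 ≤ m) (hn : 1 ≤ n) (hr : 2 ≤ r) :
    Module.finrank F
        (Algebra.adjoin F (Matrix.vecMulLinear '' swapGens F m (N := m + n) r :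
          Set (Module.End F ((Fin r → Fin (m + n)) → F))))
      = ∑ lam ∈ hookFinset m n r, fSYT lam ^ 2 := by
  obtain ⟨N, rfl⟩ : ∃ N, r = N + 1 := ⟨r - 1, by omega⟩
  classical
  obtain ⟨σ, e, hσ, hinj, he, hspan⟩ := exists_matrixUnits F N
  obtain ⟨θ, hθ⟩ := exists_signedHom F m (m + n) N
  rw [vecMulLinear_image_swapGens, adjoin_signedSwap hθ,
    finrank_range_of_matrixUnits (fun t : StdTab (N + 1) => tabShape t.1) e
      (fun x y z w hxy hzw => matrixUnits_mul hinj he hxy hzw) hspan, sum_fSYT_sq]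
  refine Nat.card_congr (Equiv.subtypeEquivRight fun p => and_congr_right fun _ => ?_)
  exact ⟨corner_notMem_of_apply_ne_zero hσ hinj he hspan hθ,
    apply_ne_zero_of_corner_notMem hσ hinj he hθ⟩
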